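/- arXiv:2306.17731 — 2 statements merged into one kernel-verified Lean document; each statement's English description precedes it below -/
import Mathlib

section
/- Let f be a C^{1+bv} contraction of [0,1). Then f is the time-1 map of a unique C^1 contracting flow (f^t) on [0,1). Moreover, if f extends to a C^{1+bv} diffeomorphism of the closed interval [0,1], then there exist universal constants C > 0 and δ > 0 (independent of f) such that whenever ||f − id||_1 + var(log Df) ≤ δ, one has ||(d/dt)|_{t=0} f^t||_∞ + max_{t∈[−1,1]} ||log Df^t||_∞ ≤ C·(||f − id||_1 + var(log Df)). -/
open Set MeasureTheory Filter Topology

noncomputable section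

/-- `Φ`, together with its spatial derivative `Φ'`, is a `C¹` flow on `s ⊆ ℝ` (extended by the
identity outside of `s`): a continuous group homomorphism from `(ℝ,+)` to the
orientation-preserving `C¹` diffeomorphisms of `s` with the `C¹` topology (uniform `C¹`
convergence on compact subsets of `s`). -/
def IsC1FlowOn (s : Set ℝ) (Φ Φ' : ℝ → ℝ → ℝ) : Prop :=
  (∀ x : ℝ, Φ 0 x = x) ∧
  (∀ t u : ℝ, ∀ x : ℝ, Φ (t + u) x = Φ t (Φ u x)) ∧
  (∀ t : ℝ, ∀ x ∉ s, Φ t x = x) ∧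
  (∀ t : ℝ, BijOn (Φ t) s s) ∧
  (∀ t : ℝ, ∀ x ∈ s, HasDerivWithinAt (Φ t) (Φ' t x) s x) ∧
  (∀ t : ℝ, ContinuousOn (Φ' t) s) ∧
  (∀ t : ℝ, ∀ x ∈ s, 0 < Φ' t x) ∧
  (∀ t₀ : ℝ, ∀ K : Set ℝ, IsCompact K → K ⊆ s → ∀ ε > (0:ℝ), ∃ δ > (0:ℝ), ∀ t : ℝ,
    |t - t₀| < δ → ∀ x ∈ K,
      |Φ t x - Φ t₀ x| + |Real.log (Φ' t x) - Real.log (Φ' t₀ x)| < ε)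


/-- The data used to build the flow: a `C¹` contraction on `(0,1)` with control `W` on `log f'`. -/
structure SzHyp (f f' W : ℝ → ℝ) : Prop where
  maps : ∀ x ∈ Ioo (0:ℝ) 1, f x ∈ Ioo (0:ℝ) 1
  surj : ∀ y ∈ Ioo (0:ℝ) 1, ∃ x ∈ Ioo (0:ℝ) 1, f x = y
  lt : ∀ x ∈ Ioo (0:ℝ) 1, f x < x
  der : ∀ x ∈ Ioo (0:ℝ) 1, HasDerivAt f (f' x) x
  pos : ∀ x ∈ Ioo (0:ℝ) 1, 0 < f' x
  cont : ContinuousOn f' (Ioo (0:ℝ) 1)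
  lim : Tendsto W (𝓝[>] 0) (𝓝 0)
  bd : ∀ y ∈ Ioo (0:ℝ) 1, ∀ z ∈ Ioo (0:ℝ) 1, z ≤ y →
    |Real.log (f' y) - Real.log (f' z)| ≤ W y - W z

theorem exists_W (g : ℝ → ℝ) (hg : BoundedVariationOn g (Ico (0:ℝ) 1)) :
    ∃ W : ℝ → ℝ, Tendsto W (𝓝[>] 0) (𝓝 0) ∧
      (∀ y ∈ Ioo (0:ℝ) 1, ∀ z ∈ Ioo (0:ℝ) 1, z ≤ y → |g y - g z| ≤ W y - W z) ∧
      (∀ y ∈ Ioo (0:ℝ) 1, W y ≤ (eVariationOn g (Ico (0:ℝ) 1)).toReal) := by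
  have hl := hg.locallyBoundedVariationOn
  have h0 : (0:ℝ) ∈ Ico (0:ℝ) 1 := by simp
  set W0 := variationOnFromTo g (Ico (0:ℝ) 1) 0 with hW0
  have hmono : MonotoneOn W0 (Ico (0:ℝ) 1) := variationOnFromTo.monotoneOn hl h0
  have hsub : Ioo (0:ℝ) 1 ⊆ Ico (0:ℝ) 1 := Ioo_subset_Ico_self
  have hnn : ∀ y ∈ Ioo (0:ℝ) 1, 0 ≤ W0 y := fun y hy =>
    variationOnFromTo.nonneg_of_le g _ hy.1.le
  have hbdd : BddBelow (W0 '' Ioo (0:ℝ) 1) := ⟨0, by rintro _ ⟨y, hy, rfl⟩; exact hnn y hy⟩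
  have ht := (hmono.mono hsub).tendsto_nhdsWithin_Ioo_right ⟨1/2, by norm_num, by norm_num⟩ hbdd
  set l := sInf (W0 '' Ioo (0:ℝ) 1) with hlw
  have hl0 : 0 ≤ l := Real.sInf_nonneg (by rintro _ ⟨y, hy, rfl⟩; exact hnn y hy)
  refine ⟨fun x => W0 x - l, by simpa using ht.sub_const l, ?_, ?_⟩
  · intro y hy z hz hzy
    have h1 : W0 z + variationOnFromTo g (Ico (0:ℝ) 1) z y = W0 y :=
      variationOnFromTo.add hl h0 (hsub hz) (hsub hy)
    have h2 : |g y - g z| ≤ variationOnFromTo g (Ico (0:ℝ) 1) z y := by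
      rw [variationOnFromTo.eq_of_le _ _ hzy]
      have := eVariationOn.edist_le g (s := Ico (0:ℝ) 1 ∩ Icc z y) (x := y) (y := z)
        ⟨hsub hy, hzy, le_rfl⟩ ⟨hsub hz, le_rfl, hzy⟩
      have h3 := ENNReal.toReal_mono (hl z y (hsub hz) (hsub hy)) this
      rwa [← dist_edist, Real.dist_eq] at h3
    simp only
    linarith
  · intro y hy
    have : W0 y ≤ (eVariationOn g (Ico (0:ℝ) 1)).toReal := by
      rw [hW0, variationOnFromTo.eq_of_le _ _ hy.1.le]
      exact ENNReal.toReal_mono hg (eVariationOn.mono g inter_subset_left)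
    simp only
    linarith

namespace SzHyp

variable {f f' W : ℝ → ℝ}

theorem W_nonneg (h : SzHyp f f' W) : ∀ x ∈ Ioo (0:ℝ) 1, 0 ≤ W x := by
  intro x hx
  refine le_of_tendsto h.lim ?_
  filter_upwards [Ioo_mem_nhdsGT hx.1] with z hz
  have := h.bd x hx z ⟨hz.1, hz.2.trans hx.2⟩ hz.2.le
  linarith [abs_nonneg (Real.log (f' x) - Real.log (f' z))]

theorem strictMono (h : SzHyp f f' W) : StrictMonoOn f (Ioo (0:ℝ) 1) := by
  apply strictMonoOn_of_deriv_pos (convex_Ioo 0 1)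
  · exact fun x hx => (h.der x hx).continuousAt.continuousWithinAt
  · intro x hx
    rw [interior_Ioo] at hx
    rw [(h.der x hx).deriv]; exact h.pos x hx

theorem iter_mem (h : SzHyp f f' W) (n : ℕ) : ∀ x ∈ Ioo (0:ℝ) 1, f^[n] x ∈ Ioo (0:ℝ) 1 := by
  induction n with
  | zero => intro x hx; simpa using hx
  | succ n ih => intro x hx; rw [Function.iterate_succ_apply']; exact h.maps _ (ih x hx)

theorem iter_mono (h : SzHyp f f' W) (n : ℕ) : ∀ x ∈ Ioo (0:ℝ) 1, ∀ y ∈ Ioo (0:ℝ) 1, x ≤ y →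
    f^[n] x ≤ f^[n] y := by
  induction n with
  | zero => intro x hx y hy hxy; simpa using hxy
  | succ n ih =>
    intro x hx y hy hxy
    rw [Function.iterate_succ_apply', Function.iterate_succ_apply']
    exact h.strictMono.monotoneOn (h.iter_mem n x hx) (h.iter_mem n y hy) (ih x hx y hy hxy)

theorem iter_tendsto (h : SzHyp f f' W) {x : ℝ} (hx : x ∈ Ioo (0:ℝ) 1) :
    Tendsto (fun n => f^[n] x) atTop (𝓝[>] 0) := by
  have hanti : Antitone (fun n => f^[n] x) := antitone_nat_of_succ_le fun n => by
    rw [Function.iterate_succ_apply']; exact (h.lt _ (h.iter_mem n x hx)).le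
  have hbdd : BddBelow (range (fun n => f^[n] x)) :=
    ⟨0, by rintro _ ⟨n, rfl⟩; exact (h.iter_mem n x hx).1.le⟩
  have ht := tendsto_atTop_ciInf hanti hbdd
  set l := ⨅ n, f^[n] x with hl
  have hl0 : 0 ≤ l := le_ciInf fun n => (h.iter_mem n x hx).1.le
  have hl1 : l < 1 := (ciInf_le hbdd 0).trans_lt (by simpa using hx.2)
  have hl2 : l = 0 := by
    by_contra hne
    have hlm : l ∈ Ioo (0:ℝ) 1 := ⟨lt_of_le_of_ne hl0 (Ne.symm hne), hl1⟩
    have h1 : Tendsto (fun n => f (f^[n] x)) atTop (𝓝 (f l)) :=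
      (h.der l hlm).continuousAt.tendsto.comp ht
    have h2 : Tendsto (fun n => f (f^[n] x)) atTop (𝓝 l) := by
      have := (tendsto_add_atTop_iff_nat 1).2 ht
      simpa [Function.iterate_succ_apply'] using this
    have := tendsto_nhds_unique h1 h2
    exact absurd (h.lt l hlm) (by rw [this]; exact lt_irrefl _)
  rw [hl2] at ht
  exact tendsto_nhdsWithin_iff.2 ⟨ht, Eventually.of_forall fun n => (h.iter_mem n x hx).1⟩

/-- mean value formula for the displacement -/
theorem mvt (h : SzHyp f f' W) {x y : ℝ} (hx : 0 < x) (hxy : x < y) (hy : y < 1) :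
    ∃ c ∈ Ioo x y, f y - f x = f' c * (y - x) := by
  obtain ⟨c, hc, hc'⟩ := exists_hasDerivAt_eq_slope f f' hxy
    (fun z hz => (h.der z ⟨hx.trans_le hz.1, hz.2.trans_lt hy⟩).continuousAt.continuousWithinAt)
    (fun z hz => h.der z ⟨hx.trans hz.1, hz.2.trans hy⟩)
  refine ⟨c, hc, ?_⟩
  rw [hc', div_mul_cancel₀]
  exact ne_of_gt (sub_pos.2 hxy)

/-- the cocycle -/
def u (f f' : ℝ → ℝ) (x : ℝ) : ℝ :=
  Real.log (f x - f (f x)) - Real.log (x - f x) - Real.log (f' x)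

theorem u_bound (h : SzHyp f f' W) {x : ℝ} (hx : x ∈ Ioo (0:ℝ) 1) :
    |u f f' x| ≤ W x - W (f x) := by
  have hfx := h.maps x hx
  obtain ⟨c, hc, hc'⟩ := h.mvt hfx.1 (h.lt x hx) hx.2
  have hcm : c ∈ Ioo (0:ℝ) 1 := ⟨hfx.1.trans hc.1, hc.2.trans hx.2⟩
  have h1 := h.bd x hx c hcm hc.2.le
  have h2 := h.bd c hcm (f x) hfx hc.1.le
  have h3 : u f f' x = Real.log (f' c) - Real.log (f' x) := by
    unfold u
    rw [hc', Real.log_mul (h.pos c hcm).ne' (sub_pos.2 (h.lt x hx)).ne']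
    ring
  rw [h3, abs_sub_comm]
  linarith [abs_nonneg (Real.log (f' c) - Real.log (f' (f x)))]

theorem sum_u_le (h : SzHyp f f' W) {x : ℝ} (hx : x ∈ Ioo (0:ℝ) 1) (n : ℕ) :
    ∑ i ∈ Finset.range n, |u f f' (f^[i] x)| ≤ W x := by
  have : ∑ i ∈ Finset.range n, |u f f' (f^[i] x)| ≤ W x - W (f^[n] x) := by
    induction n with
    | zero => simp
    | succ n ih =>
      rw [Finset.sum_range_succ, Function.iterate_succ_apply']
      linarith [h.u_bound (h.iter_mem n x hx)]
  linarith [h.W_nonneg _ (h.iter_mem n x hx)]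

/-- log of the density -/
def S (f f' : ℝ → ℝ) (x : ℝ) : ℝ := ∑' n : ℕ, u f f' (f^[n] x)

theorem summable_u (h : SzHyp f f' W) {x : ℝ} (hx : x ∈ Ioo (0:ℝ) 1) :
    Summable (fun n : ℕ => u f f' (f^[n] x)) :=
  Summable.of_abs (summable_of_sum_range_le (fun _ => abs_nonneg _) (h.sum_u_le hx))

theorem S_bound (h : SzHyp f f' W) {x : ℝ} (hx : x ∈ Ioo (0:ℝ) 1) : |S f f' x| ≤ W x := by
  have h1 := norm_tsum_le_tsum_norm (f := fun n : ℕ => u f f' (f^[n] x)) (h.summable_u hx).norm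
  exact h1.trans (Real.tsum_le_of_sum_range_le (fun _ => norm_nonneg _) (h.sum_u_le hx))

theorem S_split (h : SzHyp f f' W) {x : ℝ} (hx : x ∈ Ioo (0:ℝ) 1) (n : ℕ) :
    S f f' x = ∑ i ∈ Finset.range n, u f f' (f^[i] x) + S f f' (f^[n] x) := by
  unfold S
  rw [← (h.summable_u hx).sum_add_tsum_nat_add n]
  simp only [Function.iterate_add_apply]

theorem contF (h : SzHyp f f' W) : ContinuousOn f (Ioo (0:ℝ) 1) :=
  fun x hx => (h.der x hx).continuousAt.continuousWithinAt

theorem iter_cont (h : SzHyp f f' W) (n : ℕ) : ContinuousOn (f^[n]) (Ioo (0:ℝ) 1) :=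
  h.contF.iterate (fun x hx => h.maps x hx) n

theorem u_cont (h : SzHyp f f' W) : ContinuousOn (u f f') (Ioo (0:ℝ) 1) := by
  have hm : MapsTo f (Ioo (0:ℝ) 1) (Ioo (0:ℝ) 1) := fun x hx => h.maps x hx
  unfold u
  refine ((ContinuousOn.log ?_ ?_).sub (ContinuousOn.log ?_ ?_)).sub (h.cont.log ?_)
  · exact h.contF.sub (h.contF.comp h.contF hm)
  · exact fun x hx => (sub_pos.2 (h.lt _ (h.maps x hx))).ne'
  · exact continuousOn_id.sub h.contF
  · exact fun x hx => (sub_pos.2 (h.lt _ hx)).ne'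
  · exact fun x hx => (h.pos x hx).ne'

theorem S_cont (h : SzHyp f f' W) : ContinuousOn (S f f') (Ioo (0:ℝ) 1) := by
  have key : ∀ a ∈ Ioo (0:ℝ) 1, ContinuousOn (S f f') (Ioo 0 a) := by
    intro a ha
    have hsub : Ioo 0 a ⊆ Ioo (0:ℝ) 1 := Ioo_subset_Ioo_right ha.2.le
    have hu : TendstoUniformlyOn (fun n x => ∑ i ∈ Finset.range n, u f f' (f^[i] x))
        (S f f') atTop (Ioo 0 a) := by
      rw [Metric.tendstoUniformlyOn_iff]
      intro ε hε
      have := (h.lim.comp (h.iter_tendsto ha)).eventually (gt_mem_nhds hε)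
      filter_upwards [this] with n hn x hx
      have hn' : W (f^[n] a) < ε := hn
      rw [h.S_split (hsub hx) n, Real.dist_eq, add_sub_cancel_left]
      have hxn := h.iter_mem n x (hsub hx)
      have han := h.iter_mem n a ha
      have h1 := h.S_bound hxn
      have h2 := h.bd _ han _ hxn (h.iter_mono n x (hsub hx) a ha hx.2.le)
      linarith [abs_nonneg (Real.log (f' (f^[n] a)) - Real.log (f' (f^[n] x)))]
    refine hu.continuousOn (Eventually.of_forall fun n => ?_).frequently
    refine continuousOn_finsetSum _ fun i _ => ?_
    exact (h.u_cont.comp (h.iter_cont i) (fun x hx => h.iter_mem i x hx)).mono hsub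
  intro x hx
  obtain ⟨a, ha1, ha2⟩ := exists_between hx.2
  exact ((key a ⟨hx.1.trans ha1, ha2⟩).continuousAt (Ioo_mem_nhds hx.1 ha1)).continuousWithinAt

theorem S_lim (h : SzHyp f f' W) : Tendsto (S f f') (𝓝[>] 0) (𝓝 0) := by
  refine squeeze_zero_norm' ?_ h.lim
  filter_upwards [Ioo_mem_nhdsGT (zero_lt_one' ℝ)] with x hx
  exact h.S_bound hx

/-- unnormalised speed -/
def X0 (f f' : ℝ → ℝ) (x : ℝ) : ℝ := Real.exp (S f f' x) * (x - f x)

theorem X0_pos (h : SzHyp f f' W) {x : ℝ} (hx : x ∈ Ioo (0:ℝ) 1) : 0 < X0 f f' x :=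
  mul_pos (Real.exp_pos _) (sub_pos.2 (h.lt x hx))

theorem X0_cont (h : SzHyp f f' W) : ContinuousOn (X0 f f') (Ioo (0:ℝ) 1) :=
  h.S_cont.rexp.mul (continuousOn_id.sub h.contF)

theorem X0_f (h : SzHyp f f' W) {x : ℝ} (hx : x ∈ Ioo (0:ℝ) 1) :
    X0 f f' (f x) = f' x * X0 f f' x := by
  have h1 := h.S_split hx 1
  simp only [Finset.range_one, Finset.sum_singleton, Function.iterate_zero, id,
    Function.iterate_one] at h1
  have hfx := h.maps x hx
  have p1 := sub_pos.2 (h.lt x hx)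
  have p2 := sub_pos.2 (h.lt _ hfx)
  unfold X0
  rw [h1, Real.exp_add, u, Real.exp_sub, Real.exp_sub, Real.exp_log p1, Real.exp_log p2,
    Real.exp_log (h.pos x hx)]
  have := (h.pos x hx).ne'
  field_simp

theorem exists_tau (h : SzHyp f f' W) :
    ∃ τ : ℝ → ℝ, ∃ T > (0:ℝ), (∀ x ∈ Ioo (0:ℝ) 1, HasDerivAt τ (1 / X0 f f' x) x) ∧
      ∀ x ∈ Ioo (0:ℝ) 1, τ (f x) = τ x - T := by
  have hhalf : (1/2:ℝ) ∈ Ioo (0:ℝ) 1 := by constructor <;> norm_num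
  have hc : ContinuousOn (fun x => 1 / X0 f f' x) (Ioo (0:ℝ) 1) :=
    continuousOn_const.div h.X0_cont fun x hx => (h.X0_pos hx).ne'
  set τ : ℝ → ℝ := fun x => ∫ y in (1/2:ℝ)..x, 1 / X0 f f' y with hτ
  have hd : ∀ x ∈ Ioo (0:ℝ) 1, HasDerivAt τ (1 / X0 f f' x) x := by
    intro x hx
    apply intervalIntegral.integral_hasDerivAt_right
    · apply ContinuousOn.intervalIntegrable
      exact hc.mono (ordConnected_Ioo.uIcc_subset hhalf hx)
    · exact hc.stronglyMeasurableAtFilter isOpen_Ioo x hx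
    · exact hc.continuousAt (isOpen_Ioo.mem_nhds hx)
  have hd2 : ∀ x ∈ Ioo (0:ℝ) 1, HasDerivAt (fun x => τ (f x) - τ x) 0 x := by
    intro x hx
    have h1 := ((hd _ (h.maps x hx)).comp x (h.der x hx)).sub (hd x hx)
    refine h1.congr_deriv ?_
    rw [h.X0_f hx]
    have := (h.pos x hx).ne'
    have := (h.X0_pos hx).ne'
    field_simp
    ring
  have hconst : ∀ x ∈ Ioo (0:ℝ) 1, τ (f x) - τ x = τ (f (1/2)) - τ (1/2) := by
    intro x hx
    exact isOpen_Ioo.is_const_of_deriv_eq_zero (convex_Ioo (0:ℝ) 1).isPreconnected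
      (fun y hy => (hd2 y hy).differentiableAt.differentiableWithinAt)
      (fun y hy => (hd2 y hy).deriv) hx hhalf
  have hmono : StrictMonoOn τ (Ioo (0:ℝ) 1) := by
    apply strictMonoOn_of_deriv_pos (convex_Ioo 0 1)
    · exact fun x hx => (hd x hx).continuousAt.continuousWithinAt
    · intro x hx
      rw [interior_Ioo] at hx
      rw [(hd x hx).deriv]; exact one_div_pos.2 (h.X0_pos hx)
  refine ⟨τ, τ (1/2) - τ (f (1/2)), sub_pos.2 (hmono (h.maps _ hhalf) hhalf (h.lt _ hhalf)),
    hd, fun x hx => ?_⟩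
  linarith [hconst x hx]

end SzHyp

/-- A contraction with its normalised time function `θ` and the inverse `σ` of `θ`. -/
structure SzFlow (f f' W : ℝ → ℝ) (T : ℝ) (θ σ : ℝ → ℝ) : Prop extends SzHyp f f' W where
  Tpos : 0 < T
  dθ : ∀ x ∈ Ioo (0:ℝ) 1, HasDerivAt θ (1 / (T * SzHyp.X0 f f' x)) x
  θf : ∀ x ∈ Ioo (0:ℝ) 1, θ (f x) = θ x - 1
  θmono : StrictMonoOn θ (Ioo (0:ℝ) 1)
  σmem : ∀ s, σ s ∈ Ioo (0:ℝ) 1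
  θσ : ∀ s, θ (σ s) = s

theorem SzHyp.exists_flow {f f' W : ℝ → ℝ} (h : SzHyp f f' W) :
    ∃ T θ σ, SzFlow f f' W T θ σ := by
  obtain ⟨τ, T, hT, hd, hτf⟩ := h.exists_tau
  set θ : ℝ → ℝ := fun x => τ x / T with hθ
  have hhalf : (1/2:ℝ) ∈ Ioo (0:ℝ) 1 := by constructor <;> norm_num
  have hd' : ∀ x ∈ Ioo (0:ℝ) 1, HasDerivAt θ (1 / (T * SzHyp.X0 f f' x)) x := by
    intro x hx
    refine ((hd x hx).div_const T).congr_deriv ?_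
    rw [div_div, mul_comm]
  have hf : ∀ x ∈ Ioo (0:ℝ) 1, θ (f x) = θ x - 1 := by
    intro x hx
    simp only [hθ]
    rw [hτf x hx, sub_div, div_self hT.ne']
  have hmono : StrictMonoOn θ (Ioo (0:ℝ) 1) := by
    apply strictMonoOn_of_deriv_pos (convex_Ioo 0 1)
    · exact fun x hx => (hd' x hx).continuousAt.continuousWithinAt
    · intro x hx
      rw [interior_Ioo] at hx
      rw [(hd' x hx).deriv]; exact one_div_pos.2 (mul_pos hT (h.X0_pos hx))
  have hlow : ∀ n : ℕ, ∃ x ∈ Ioo (0:ℝ) 1, θ x = θ (1/2) - n := by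
    intro n
    induction n with
    | zero => exact ⟨1/2, hhalf, by simp⟩
    | succ n ih =>
      obtain ⟨x, hx, hx'⟩ := ih
      refine ⟨f x, h.maps x hx, ?_⟩
      rw [hf x hx, hx']; push_cast; ring
  have hhigh : ∀ n : ℕ, ∃ x ∈ Ioo (0:ℝ) 1, θ x = θ (1/2) + n := by
    intro n
    induction n with
    | zero => exact ⟨1/2, hhalf, by simp⟩
    | succ n ih =>
      obtain ⟨x, hx, hx'⟩ := ih
      obtain ⟨y, hy, rfl⟩ := h.surj x hx
      refine ⟨y, hy, ?_⟩
      rw [hf y hy] at hx'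
      push_cast; linarith
  have hsurj : ∀ s, ∃ x ∈ Ioo (0:ℝ) 1, θ x = s := by
    intro s
    obtain ⟨n, hn⟩ := exists_nat_ge |s - θ (1/2)|
    obtain ⟨a, ha, ha'⟩ := hlow n
    obtain ⟨b, hb, hb'⟩ := hhigh n
    have := abs_le.1 hn
    exact (convex_Ioo (0:ℝ) 1).isPreconnected.intermediate_value ha hb
      (fun x hx => (hd' x hx).continuousAt.continuousWithinAt)
      ⟨by linarith [this.1], by linarith [this.2]⟩
  choose σ hσ1 hσ2 using hsurj
  exact ⟨T, θ, σ, ⟨h, hT, hd', hf, hmono, hσ1, hσ2⟩⟩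

namespace SzFlow

open SzHyp

variable {f f' W θ σ : ℝ → ℝ} {T : ℝ}

theorem σθ (h : SzFlow f f' W T θ σ) {x : ℝ} (hx : x ∈ Ioo (0:ℝ) 1) : σ (θ x) = x :=
  h.θmono.injOn (h.σmem _) hx (h.θσ _)

theorem σmono (h : SzFlow f f' W T θ σ) : StrictMono σ := by
  intro s t hst
  by_contra hcon
  have := h.θmono.monotoneOn (h.σmem t) (h.σmem s) (not_lt.1 hcon)
  rw [h.θσ, h.θσ] at this
  linarith

theorem σcont (h : SzFlow f f' W T θ σ) : Continuous σ := by
  rw [continuous_iff_continuousAt]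
  intro s
  refine (h.σmono.strictMonoOn univ).continuousAt_of_image_mem_nhds univ_mem ?_
  refine mem_of_superset (isOpen_Ioo.mem_nhds (h.σmem s)) fun x hx => ?_
  exact ⟨θ x, mem_univ _, h.σθ hx⟩

theorem dσ (h : SzFlow f f' W T θ σ) (s : ℝ) : HasDerivAt σ (T * X0 f f' (σ s)) s := by
  have hp := mul_pos h.Tpos (h.X0_pos (h.σmem s))
  have := HasDerivAt.of_local_left_inverse (f := θ) (g := σ) (a := s) h.σcont.continuousAt
    (h.dθ _ (h.σmem s)) (one_div_pos.2 hp).ne' (Eventually.of_forall h.θσ)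
  simpa using this

theorem θcont (h : SzFlow f f' W T θ σ) : ContinuousOn θ (Ioo (0:ℝ) 1) :=
  fun x hx => (h.dθ x hx).continuousAt.continuousWithinAt

theorem σlim (h : SzFlow f f' W T θ σ) : Tendsto σ atBot (𝓝[>] 0) := by
  refine tendsto_nhdsWithin_iff.2 ⟨?_, Eventually.of_forall fun s => (h.σmem s).1⟩
  refine tendsto_order.2 ⟨fun a ha => Eventually.of_forall fun s => ha.trans (h.σmem s).1, ?_⟩
  intro a ha
  have hm : min a (1/2) ∈ Ioo (0:ℝ) 1 :=
    ⟨lt_min ha (by norm_num), (min_le_right _ _).trans_lt (by norm_num)⟩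
  filter_upwards [eventually_lt_atBot (θ (min a (1/2)))] with s hs
  have := h.σmono hs
  rw [h.σθ hm] at this
  exact this.trans_le (min_le_left _ _)

theorem θlim (h : SzFlow f f' W T θ σ) : Tendsto θ (𝓝[>] 0) atBot := by
  rw [tendsto_atBot]
  intro M
  filter_upwards [Ioo_mem_nhdsGT (h.σmem M).1] with x hx
  have := h.θmono ⟨hx.1, hx.2.trans (h.σmem M).2⟩ (h.σmem M) hx.2
  rw [h.θσ] at this
  exact this.le

/-- the flow on `(0,1)` -/
theorem f_eq (h : SzFlow f f' W T θ σ) {x : ℝ} (hx : x ∈ Ioo (0:ℝ) 1) : σ (θ x - 1) = f x := by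
  rw [← h.θf x hx, h.σθ (h.maps x hx)]

/-- log-derivative of the displacement along the flow -/
def A (f f' : ℝ → ℝ) (T : ℝ) (x : ℝ) : ℝ := (1 - f' x) * (T * Real.exp (S f f' x))

theorem dlog (h : SzFlow f f' W T θ σ) (s : ℝ) :
    HasDerivAt (fun s => Real.log (σ s - f (σ s))) (A f f' T (σ s)) s := by
  have hp := sub_pos.2 (h.lt _ (h.σmem s))
  have h1 := ((h.dσ s).sub ((h.der _ (h.σmem s)).comp s (h.dσ s))).log hp.ne'
  refine h1.congr_deriv ?_
  have e : (σ - f ∘ σ) s = σ s - f (σ s) := rfl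
  rw [e, A, X0]
  field_simp

theorem logD_diff (h : SzFlow f f' W T θ σ) (s t : ℝ) : ∃ c, |c| ≤ |t| ∧
    Real.log (σ (s - t) - f (σ (s - t))) - Real.log (σ s - f (σ s)) = -t * A f f' T (σ (s - c)) := by
  have hcont : Continuous (fun s => Real.log (σ s - f (σ s))) :=
    continuous_iff_continuousAt.2 fun s => (h.dlog s).continuousAt
  rcases lt_trichotomy t 0 with ht | rfl | ht
  · obtain ⟨c, hc, hc'⟩ := exists_hasDerivAt_eq_slope (fun s => Real.log (σ s - f (σ s)))
      (fun s => A f f' T (σ s)) (show s < s - t by linarith) hcont.continuousOn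
      (fun z _ => h.dlog z)
    refine ⟨s - c, ?_, ?_⟩
    · rw [abs_of_neg ht, abs_le]; constructor <;> linarith [hc.1, hc.2]
    · have ht0 : t ≠ 0 := ht.ne
      rw [sub_sub_cancel, hc', show s - t - s = -t by ring]; field_simp
  · exact ⟨0, by simp⟩
  · obtain ⟨c, hc, hc'⟩ := exists_hasDerivAt_eq_slope (fun s => Real.log (σ s - f (σ s)))
      (fun s => A f f' T (σ s)) (show s - t < s by linarith) hcont.continuousOn
      (fun z _ => h.dlog z)
    refine ⟨s - c, ?_, ?_⟩
    · rw [abs_of_pos ht, abs_le]; constructor <;> linarith [hc.1, hc.2]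
    · have ht0 : t ≠ 0 := ht.ne'
      rw [sub_sub_cancel, hc', show s - (s - t) = t by ring]; field_simp; ring

/-- log derivative of the flow -/
def ell (f f' θ σ : ℝ → ℝ) (t x : ℝ) : ℝ :=
  Real.log (X0 f f' (σ (θ x - t))) - Real.log (X0 f f' x)

theorem ell_eq (h : SzFlow f f' W T θ σ) {x : ℝ} (hx : x ∈ Ioo (0:ℝ) 1) (t : ℝ) :
    ∃ c, |c| ≤ |t| ∧ ell f f' θ σ t x =
      S f f' (σ (θ x - t)) - S f f' x - t * A f f' T (σ (θ x - c)) := by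
  obtain ⟨c, hc, hc'⟩ := h.logD_diff (θ x) t
  refine ⟨c, hc, ?_⟩
  rw [h.σθ hx] at hc'
  have hp := sub_pos.2 (h.lt _ hx)
  have hp2 := sub_pos.2 (h.lt _ (h.σmem (θ x - t)))
  unfold ell X0
  rw [Real.log_mul (Real.exp_pos _).ne' hp.ne', Real.log_mul (Real.exp_pos _).ne' hp2.ne',
    Real.log_exp, Real.log_exp]
  linarith

theorem flow_lim (h : SzFlow f f' W T θ σ) (t₀ : ℝ) :
    Tendsto (fun p : ℝ × ℝ => σ (θ p.2 - p.1)) (𝓝 t₀ ×ˢ 𝓝[>] 0) (𝓝[>] 0) := by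
  refine h.σlim.comp ?_
  have h1 : Tendsto (fun p : ℝ × ℝ => θ p.2) (𝓝 t₀ ×ˢ 𝓝[>] 0) atBot := h.θlim.comp tendsto_snd
  have h2 : Tendsto (fun p : ℝ × ℝ => -p.1) (𝓝 t₀ ×ˢ 𝓝[>] 0) (𝓝 (-t₀)) :=
    (tendsto_fst (f := 𝓝 t₀) (g := 𝓝[>] (0:ℝ))).neg
  simpa [sub_eq_add_neg] using h1.atBot_add h2

theorem ell_lim (h : SzFlow f f' W T θ σ) {lam : ℝ} (hl : Tendsto f' (𝓝[>] 0) (𝓝 lam)) (t₀ : ℝ) :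
    Tendsto (fun p : ℝ × ℝ => ell f f' θ σ p.1 p.2) (𝓝 t₀ ×ˢ 𝓝[>] 0)
      (𝓝 (-((1 - lam) * T) * t₀)) := by
  have hA : Tendsto (fun x => A f f' T x) (𝓝[>] 0) (𝓝 ((1 - lam) * T)) := by
    have h1 := (hl.const_sub 1).mul ((h.S_lim.rexp).const_mul T)
    simpa [A, Function.comp_def] using h1
  have hmem : ∀ᶠ p : ℝ × ℝ in 𝓝 t₀ ×ˢ 𝓝[>] 0, p.2 ∈ Ioo (0:ℝ) 1 :=
    tendsto_snd.eventually (Ioo_mem_nhdsGT (zero_lt_one' ℝ))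
  have hex : ∀ p : ℝ × ℝ, ∃ c, p.2 ∈ Ioo (0:ℝ) 1 → |c| ≤ |p.1| ∧ ell f f' θ σ p.1 p.2 =
      S f f' (σ (θ p.2 - p.1)) - S f f' p.2 - p.1 * A f f' T (σ (θ p.2 - c)) := by
    intro p
    by_cases hp : p.2 ∈ Ioo (0:ℝ) 1
    · obtain ⟨c, hc⟩ := h.ell_eq hp p.1
      exact ⟨c, fun _ => hc⟩
    · exact ⟨0, fun h => absurd h hp⟩
  choose c hc using hex
  have hcl : Tendsto (fun p : ℝ × ℝ => σ (θ p.2 - c p)) (𝓝 t₀ ×ˢ 𝓝[>] 0) (𝓝[>] 0) := by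
    refine h.σlim.comp ?_
    have h1 : Tendsto (fun p : ℝ × ℝ => θ p.2) (𝓝 t₀ ×ˢ 𝓝[>] 0) atBot := h.θlim.comp tendsto_snd
    have h2 : Tendsto (fun p : ℝ × ℝ => |p.1|) (𝓝 t₀ ×ˢ 𝓝[>] 0) (𝓝 |t₀|) :=
      (tendsto_fst (f := 𝓝 t₀) (g := 𝓝[>] (0:ℝ))).abs
    refine tendsto_atBot_mono' _ ?_ (h1.atBot_add h2)
    filter_upwards [hmem] with p hp
    linarith [(abs_le.1 (hc p hp).1).1]
  have hS1 := h.S_lim.comp (h.flow_lim t₀)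
  have hS2 := h.S_lim.comp (tendsto_snd (f := 𝓝 t₀) (g := 𝓝[>] (0:ℝ)))
  have hA1 := (tendsto_fst (f := 𝓝 t₀) (g := 𝓝[>] (0:ℝ))).mul (hA.comp hcl)
  have := (hS1.sub hS2).sub hA1
  have heq : -((1 - lam) * T) * t₀ = 0 - 0 - t₀ * ((1 - lam) * T) := by ring
  rw [heq]
  refine this.congr' ?_
  filter_upwards [hmem] with p hp
  rw [(hc p hp).2]
  rfl

end SzFlow

namespace SzFlow

open SzHyp

variable {f f' W θ σ : ℝ → ℝ} {T : ℝ}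

theorem commute_const (h : SzFlow f f' W T θ σ) {g g' : ℝ → ℝ} {μ : ℝ} (hμ : 0 < μ)
    (hgm : ∀ x ∈ Ioo (0:ℝ) 1, g x ∈ Ioo (0:ℝ) 1)
    (hgf : ∀ x ∈ Ioo (0:ℝ) 1, g (f x) = f (g x))
    (hgd : ∀ x ∈ Ioo (0:ℝ) 1, HasDerivAt g (g' x) x)
    (hgp : ∀ x ∈ Ioo (0:ℝ) 1, 0 < g' x)
    (hgl : Tendsto g (𝓝[>] 0) (𝓝[>] 0))
    (hgl' : Tendsto g' (𝓝[>] 0) (𝓝 μ)) {x y : ℝ} (hx : x ∈ Ioo (0:ℝ) 1) (hy : y ∈ Ioo (0:ℝ) 1) :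
    θ (g x) - θ x = θ (g y) - θ y := by
  set r : ℝ → ℝ := fun x => Real.log (X0 f f' (g x)) - Real.log (g' x) - Real.log (X0 f f' x) with hr
  have hchain : ∀ x ∈ Ioo (0:ℝ) 1, g' (f x) * f' x = f' (g x) * g' x := by
    intro x hx
    have h1 := (hgd _ (h.maps x hx)).comp x (h.der x hx)
    have h2 := (h.der _ (hgm x hx)).comp x (hgd x hx)
    refine h1.unique (h2.congr_of_eventuallyEq ?_)
    filter_upwards [isOpen_Ioo.mem_nhds hx] with z hz
    exact hgf z hz
  have hrf : ∀ x ∈ Ioo (0:ℝ) 1, r (f x) = r x := by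
    intro x hx
    have h1 := congrArg Real.log (hchain x hx)
    rw [Real.log_mul (hgp _ (h.maps x hx)).ne' (h.pos x hx).ne',
      Real.log_mul (h.pos _ (hgm x hx)).ne' (hgp x hx).ne'] at h1
    simp only [hr]
    rw [hgf x hx, h.X0_f hx, h.X0_f (hgm x hx),
      Real.log_mul (h.pos _ (hgm x hx)).ne' (h.X0_pos (hgm x hx)).ne',
      Real.log_mul (h.pos _ hx).ne' (h.X0_pos hx).ne']
    linarith
  have hex : ∀ x, ∃ c, x ∈ Ioo (0:ℝ) 1 → c ∈ Ioo 0 x ∧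
      r x = S f f' (g x) - S f f' x + (Real.log (g' c) - Real.log (g' x)) := by
    intro x
    by_cases hx : x ∈ Ioo (0:ℝ) 1
    · have hfx := h.maps x hx
      obtain ⟨c, hc, hc'⟩ := exists_hasDerivAt_eq_slope g g' (h.lt x hx)
        (fun z hz => (hgd z ⟨hfx.1.trans_le hz.1, hz.2.trans_lt hx.2⟩).continuousAt.continuousWithinAt)
        (fun z hz => hgd z ⟨hfx.1.trans hz.1, hz.2.trans hx.2⟩)
      refine ⟨c, fun _ => ⟨⟨hfx.1.trans hc.1, hc.2⟩, ?_⟩⟩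
      have hp := sub_pos.2 (h.lt _ hx)
      have hp2 := sub_pos.2 (h.lt _ (hgm x hx))
      rw [hc', hgf x hx, Real.log_div hp2.ne' hp.ne']
      simp only [hr]
      unfold X0
      rw [Real.log_mul (Real.exp_pos _).ne' hp.ne', Real.log_mul (Real.exp_pos _).ne' hp2.ne',
        Real.log_exp, Real.log_exp]
      ring
    · exact ⟨0, fun h => absurd h hx⟩
  choose c hc using hex
  have hIoo : ∀ᶠ x : ℝ in 𝓝[>] 0, x ∈ Ioo (0:ℝ) 1 := Ioo_mem_nhdsGT (zero_lt_one' ℝ)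
  have hcl : Tendsto c (𝓝[>] 0) (𝓝[>] 0) := by
    refine tendsto_nhdsWithin_iff.2 ⟨?_, ?_⟩
    · refine tendsto_of_tendsto_of_tendsto_of_le_of_le' (tendsto_const_nhds (x := (0:ℝ)))
        (tendsto_id.mono_left nhdsWithin_le_nhds : Tendsto (fun x : ℝ => x) (𝓝[>] 0) (𝓝 0)) ?_ ?_
      · filter_upwards [hIoo] with x hx using (hc x hx).1.1.le
      · filter_upwards [hIoo] with x hx using (hc x hx).1.2.le
    · filter_upwards [hIoo] with x hx using (hc x hx).1.1
  have hrl : Tendsto r (𝓝[>] 0) (𝓝 0) := by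
    have h1 := ((h.S_lim.comp hgl).sub h.S_lim).add
      (((hgl'.comp hcl).log hμ.ne').sub (hgl'.log hμ.ne'))
    have e : (0:ℝ) = 0 - 0 + (Real.log μ - Real.log μ) := by ring
    rw [← e] at h1
    refine h1.congr' ?_
    filter_upwards [hIoo] with x hx
    exact ((hc x hx).2).symm
  have hr0 : ∀ x ∈ Ioo (0:ℝ) 1, r x = 0 := by
    intro x hx
    have h1 : ∀ n : ℕ, r (f^[n] x) = r x := by
      intro n
      induction n with
      | zero => rfl
      | succ n ih => rw [Function.iterate_succ_apply', hrf _ (h.iter_mem n x hx), ih]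
    have h2 := hrl.comp (h.iter_tendsto hx)
    have h3 : Tendsto (r ∘ fun n => f^[n] x) atTop (𝓝 (r x)) := by
      refine tendsto_const_nhds.congr fun n => (h1 n).symm
    exact tendsto_nhds_unique h3 h2
  have hX : ∀ x ∈ Ioo (0:ℝ) 1, X0 f f' (g x) = g' x * X0 f f' x := by
    intro x hx
    have h1 := hr0 x hx
    have h2 : Real.log (X0 f f' (g x)) = Real.log (g' x * X0 f f' x) := by
      rw [Real.log_mul (hgp x hx).ne' (h.X0_pos hx).ne']
      simp only [hr] at h1
      linarith
    exact Real.log_injOn_pos (h.X0_pos (hgm x hx)) (mul_pos (hgp x hx) (h.X0_pos hx)) h2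
  have hd : ∀ x ∈ Ioo (0:ℝ) 1, HasDerivAt (fun x => θ (g x) - θ x) 0 x := by
    intro x hx
    have h1 := ((h.dθ _ (hgm x hx)).comp x (hgd x hx)).sub (h.dθ x hx)
    refine h1.congr_deriv ?_
    rw [hX x hx]
    have := (hgp x hx).ne'
    have := (h.X0_pos hx).ne'
    have := h.Tpos.ne'
    field_simp
    ring
  exact isOpen_Ioo.is_const_of_deriv_eq_zero (convex_Ioo (0:ℝ) 1).isPreconnected
      (fun y hy => (hd y hy).differentiableAt.differentiableWithinAt)
      (fun y hy => (hd y hy).deriv) hx hy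

/-- the flow -/
def Phi (θ σ : ℝ → ℝ) (t x : ℝ) : ℝ := if x ∈ Ioo (0:ℝ) 1 then σ (θ x - t) else x

/-- log of its derivative -/
def L (f f' θ σ : ℝ → ℝ) (κ t x : ℝ) : ℝ :=
  if x ∈ Ioo (0:ℝ) 1 then ell f f' θ σ t x else -κ * t

theorem Phi_mem {t x : ℝ} (hx : x ∈ Ioo (0:ℝ) 1) : Phi θ σ t x = σ (θ x - t) := if_pos hx

theorem Phi_not {t x : ℝ} (hx : x ∉ Ioo (0:ℝ) 1) : Phi θ σ t x = x := if_neg hx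

theorem L_mem {κ t x : ℝ} (hx : x ∈ Ioo (0:ℝ) 1) : L f f' θ σ κ t x = ell f f' θ σ t x := if_pos hx

theorem L_not {κ t x : ℝ} (hx : x ∉ Ioo (0:ℝ) 1) : L f f' θ σ κ t x = -κ * t := if_neg hx

theorem cwa_zero {G : ℝ × ℝ → ℝ} {t₀ : ℝ}
    (h1 : Tendsto G (𝓝 t₀ ×ˢ 𝓝[>] 0) (𝓝 (G (t₀, 0))))
    (h2 : Continuous fun t => G (t, 0)) :
    ContinuousWithinAt G (univ ×ˢ Ico (0:ℝ) 1) (t₀, 0) := by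
  have hle : 𝓝[univ ×ˢ Ico (0:ℝ) 1] (t₀, 0) ≤ (𝓝 t₀ ×ˢ pure 0) ⊔ (𝓝 t₀ ×ˢ 𝓝[>] 0) := by
    rw [nhdsWithin_prod_eq, nhdsWithin_univ, ← Filter.prod_sup]
    refine Filter.prod_mono le_rfl ?_
    have : Ico (0:ℝ) 1 ⊆ insert 0 (Ioi 0) := by
      intro x hx
      rcases hx.1.eq_or_lt with h | h
      · left; exact h.symm
      · right; exact h
    refine (nhdsWithin_mono 0 this).trans ?_
    rw [nhdsWithin_insert]
  refine Tendsto.mono_left ?_ hle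
  refine Tendsto.sup ?_ h1
  rw [Filter.prod_pure, tendsto_map'_iff]
  exact h2.tendsto t₀

theorem X0log_cont (h : SzFlow f f' W T θ σ) :
    ContinuousOn (fun x => Real.log (X0 f f' x)) (Ioo (0:ℝ) 1) :=
  h.X0_cont.log fun x hx => (h.X0_pos hx).ne'

theorem Phi_joint (h : SzFlow f f' W T θ σ) :
    ContinuousOn (fun p : ℝ × ℝ => Phi θ σ p.1 p.2) (univ ×ˢ Ico (0:ℝ) 1) := by
  rintro ⟨t₀, x₀⟩ ⟨-, hx₀⟩
  rcases hx₀.1.eq_or_lt with h0 | h0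
  · obtain rfl : 0 = x₀ := h0
    have e : ∀ t, Phi θ σ t 0 = 0 := fun t => Phi_not (by simp)
    refine cwa_zero ?_ ?_
    · simp only [e]
      refine ((h.flow_lim t₀).mono_right nhdsWithin_le_nhds).congr' ?_
      filter_upwards [tendsto_snd.eventually (Ioo_mem_nhdsGT (zero_lt_one' ℝ))] with p hp
      exact (Phi_mem hp).symm
    · simp only [e]; exact continuous_const
  · have hx : x₀ ∈ Ioo (0:ℝ) 1 := ⟨h0, hx₀.2⟩
    refine ContinuousAt.continuousWithinAt ?_
    have h1 : ContinuousAt (fun p : ℝ × ℝ => σ (θ p.2 - p.1)) (t₀, x₀) := by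
      refine h.σcont.continuousAt.comp (ContinuousAt.sub ?_ continuousAt_fst)
      exact (h.dθ x₀ hx).continuousAt.comp (f := Prod.snd) (x := (t₀, x₀)) continuousAt_snd
    refine h1.congr ?_
    filter_upwards [continuousAt_snd.eventually (isOpen_Ioo.mem_nhds hx)] with p hp
    exact (Phi_mem hp).symm

theorem L_joint (h : SzFlow f f' W T θ σ) {lam : ℝ} (hl : Tendsto f' (𝓝[>] 0) (𝓝 lam)) :
    ContinuousOn (fun p : ℝ × ℝ => L f f' θ σ ((1 - lam) * T) p.1 p.2) (univ ×ˢ Ico (0:ℝ) 1) := by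
  rintro ⟨t₀, x₀⟩ ⟨-, hx₀⟩
  rcases hx₀.1.eq_or_lt with h0 | h0
  · obtain rfl : 0 = x₀ := h0
    have e : ∀ t, L f f' θ σ ((1 - lam) * T) t 0 = -((1 - lam) * T) * t := fun t => L_not (by simp)
    refine cwa_zero ?_ ?_
    · simp only [e]
      refine (h.ell_lim hl t₀).congr' ?_
      filter_upwards [tendsto_snd.eventually (Ioo_mem_nhdsGT (zero_lt_one' ℝ))] with p hp
      exact (L_mem hp).symm
    · simp only [e]; fun_prop
  · have hx : x₀ ∈ Ioo (0:ℝ) 1 := ⟨h0, hx₀.2⟩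
    refine ContinuousAt.continuousWithinAt ?_
    have h1 : ContinuousAt (fun p : ℝ × ℝ => σ (θ p.2 - p.1)) (t₀, x₀) := by
      refine h.σcont.continuousAt.comp (ContinuousAt.sub ?_ continuousAt_fst)
      exact (h.dθ x₀ hx).continuousAt.comp (f := Prod.snd) (x := (t₀, x₀)) continuousAt_snd
    have h2 : ContinuousAt (fun p : ℝ × ℝ => Real.log (X0 f f' (σ (θ p.2 - p.1)))) (t₀, x₀) :=
      ContinuousAt.comp (g := fun x => Real.log (X0 f f' x))
        (h.X0log_cont.continuousAt (isOpen_Ioo.mem_nhds (h.σmem _))) h1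
    have h3 : ContinuousAt (fun p : ℝ × ℝ => Real.log (X0 f f' p.2)) (t₀, x₀) :=
      ContinuousAt.comp (g := fun x => Real.log (X0 f f' x)) (f := Prod.snd)
        (h.X0log_cont.continuousAt (isOpen_Ioo.mem_nhds hx)) continuousAt_snd
    refine (h2.sub h3).congr ?_
    filter_upwards [continuousAt_snd.eventually (isOpen_Ioo.mem_nhds hx)] with p hp
    exact (L_mem hp).symm

theorem Phi_Ioo (h : SzFlow f f' W T θ σ) (t : ℝ) {x : ℝ} (hx : x ∈ Ioo (0:ℝ) 1) :
    Phi θ σ t x ∈ Ioo (0:ℝ) 1 := by rw [Phi_mem hx]; exact h.σmem _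

theorem Phi_add (h : SzFlow f f' W T θ σ) (t u x : ℝ) :
    Phi θ σ (t + u) x = Phi θ σ t (Phi θ σ u x) := by
  by_cases hx : x ∈ Ioo (0:ℝ) 1
  · rw [Phi_mem hx, Phi_mem hx, Phi_mem (h.σmem _), h.θσ]
    congr 1; ring
  · rw [Phi_not hx, Phi_not hx, Phi_not hx]

theorem Phi_zero (h : SzFlow f f' W T θ σ) (x : ℝ) : Phi θ σ 0 x = x := by
  by_cases hx : x ∈ Ioo (0:ℝ) 1
  · rw [Phi_mem hx, sub_zero, h.σθ hx]
  · rw [Phi_not hx]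

theorem Phi_deriv (h : SzFlow f f' W T θ σ) (κ t : ℝ) {x : ℝ} (hx : x ∈ Ioo (0:ℝ) 1) :
    HasDerivAt (Phi θ σ t) (Real.exp (L f f' θ σ κ t x)) x := by
  have h1 : HasDerivAt (fun x => σ (θ x - t)) _ x :=
    (h.dσ (θ x - t)).comp x ((h.dθ x hx).sub_const t)
  have h2 := h1.congr_of_eventuallyEq (f₁ := Phi θ σ t) (by
    filter_upwards [isOpen_Ioo.mem_nhds hx] with z hz using Phi_mem hz)
  refine h2.congr_deriv ?_
  rw [L_mem hx, ell, Real.exp_sub, Real.exp_log (h.X0_pos hx), Real.exp_log (h.X0_pos (h.σmem _))]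
  have := h.Tpos.ne'
  have := (h.X0_pos hx).ne'
  field_simp

theorem Phi_cont (h : SzFlow f f' W T θ σ) (t : ℝ) :
    ContinuousOn (Phi θ σ t) (Ico (0:ℝ) 1) :=
  h.Phi_joint.comp (f := fun x => (t, x)) (by fun_prop) (fun x hx => ⟨mem_univ _, hx⟩)

theorem L_cont (h : SzFlow f f' W T θ σ) {lam : ℝ} (hl : Tendsto f' (𝓝[>] 0) (𝓝 lam)) (t : ℝ) :
    ContinuousOn (L f f' θ σ ((1 - lam) * T) t) (Ico (0:ℝ) 1) :=
  (h.L_joint hl).comp (f := fun x => (t, x)) (by fun_prop) (fun x hx => ⟨mem_univ _, hx⟩)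

theorem isFlow (h : SzFlow f f' W T θ σ) {lam : ℝ} (hl : Tendsto f' (𝓝[>] 0) (𝓝 lam)) :
    IsC1FlowOn (Ico (0:ℝ) 1) (Phi θ σ)
      (fun t x => Real.exp (L f f' θ σ ((1 - lam) * T) t x)) := by
  have hmaps : ∀ t, MapsTo (Phi θ σ t) (Ico (0:ℝ) 1) (Ico (0:ℝ) 1) := by
    intro t x hx
    by_cases hx' : x ∈ Ioo (0:ℝ) 1
    · exact Ioo_subset_Ico_self (h.Phi_Ioo t hx')
    · rw [Phi_not hx']; exact hx
  refine ⟨h.Phi_zero, h.Phi_add, ?_, ?_, ?_, ?_, ?_, ?_⟩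
  · intro t x hx
    exact Phi_not fun hx' => hx (Ioo_subset_Ico_self hx')
  · intro t
    refine InvOn.bijOn (f' := Phi θ σ (-t)) ⟨?_, ?_⟩ (hmaps t) (hmaps (-t))
    · intro x _
      rw [← h.Phi_add, neg_add_cancel, h.Phi_zero]
    · intro x _
      rw [← h.Phi_add, add_neg_cancel, h.Phi_zero]
  · intro t x hx
    rcases hx.1.eq_or_lt with h0 | h0
    · obtain rfl : 0 = x := h0
      refine HasDerivWithinAt.mono ?_ (Ico_subset_Ici_self : Ico (0:ℝ) 1 ⊆ Ici 0)
      refine hasDerivWithinAt_Ici_of_tendsto_deriv (s := Ioo (0:ℝ) 1) ?_ ?_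
        (Ioo_mem_nhdsGT (zero_lt_one' ℝ)) ?_
      · exact fun z hz => (h.Phi_deriv 0 t hz).differentiableAt.differentiableWithinAt
      · exact (h.Phi_cont t 0 hx).mono Ioo_subset_Ico_self
      · have h1 := (h.L_cont hl t 0 hx).rexp.tendsto
        have h2 : Tendsto (fun x => Real.exp (L f f' θ σ ((1 - lam) * T) t x)) (𝓝[>] 0)
            (𝓝 (Real.exp (L f f' θ σ ((1 - lam) * T) t 0))) := by
          rw [← nhdsWithin_Ioo_eq_nhdsGT (zero_lt_one' ℝ)]
          exact h1.mono_left (nhdsWithin_mono _ Ioo_subset_Ico_self)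
        refine h2.congr' ?_
        filter_upwards [Ioo_mem_nhdsGT (zero_lt_one' ℝ)] with z hz
        exact ((h.Phi_deriv _ t hz).deriv).symm
    · exact (h.Phi_deriv _ t ⟨h0, hx.2⟩).hasDerivWithinAt
  · exact fun t => (h.L_cont hl t).rexp
  · exact fun t x _ => Real.exp_pos _
  · intro t₀ K hK hKs ε hε
    have hcomp : IsCompact (Icc (t₀ - 1) (t₀ + 1) ×ˢ K) := isCompact_Icc.prod hK
    have hsub : Icc (t₀ - 1) (t₀ + 1) ×ˢ K ⊆ univ ×ˢ Ico (0:ℝ) 1 := prod_mono (subset_univ _) hKs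
    have u1 := Metric.uniformContinuousOn_iff.1
      (hcomp.uniformContinuousOn_of_continuous (h.Phi_joint.mono hsub)) (ε/2) (half_pos hε)
    have u2 := Metric.uniformContinuousOn_iff.1
      (hcomp.uniformContinuousOn_of_continuous ((h.L_joint hl).mono hsub)) (ε/2) (half_pos hε)
    obtain ⟨δ₁, hδ₁, u1⟩ := u1
    obtain ⟨δ₂, hδ₂, u2⟩ := u2
    refine ⟨min 1 (min δ₁ δ₂), by positivity, fun t ht x hx => ?_⟩
    have ht1 : |t - t₀| < 1 := ht.trans_le (min_le_left _ _)
    have ht2 : |t - t₀| < δ₁ := ht.trans_le ((min_le_right _ _).trans (min_le_left _ _))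
    have ht3 : |t - t₀| < δ₂ := ht.trans_le ((min_le_right _ _).trans (min_le_right _ _))
    have ha := abs_lt.1 ht1
    have m1 : (t, x) ∈ Icc (t₀ - 1) (t₀ + 1) ×ˢ K := ⟨⟨by linarith, by linarith⟩, hx⟩
    have m2 : (t₀, x) ∈ Icc (t₀ - 1) (t₀ + 1) ×ˢ K := ⟨⟨by linarith, by linarith⟩, hx⟩
    have hdist : dist (t, x) (t₀, x) = |t - t₀| := by
      rw [Prod.dist_eq]; simp [Real.dist_eq]
    have v1 := u1 _ m1 _ m2 (by rw [hdist]; exact ht2)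
    have v2 := u2 _ m1 _ m2 (by rw [hdist]; exact ht3)
    rw [Real.dist_eq] at v1 v2
    rw [Real.log_exp, Real.log_exp]
    linarith

theorem uniq (h : SzFlow f f' W T θ σ) (hf0 : f 0 = 0) {Ψ Ψ' : ℝ → ℝ → ℝ}
    (hΨ : IsC1FlowOn (Ico (0:ℝ) 1) Ψ Ψ') (hΨf : ∀ x, Ψ 1 x = f x) (t x : ℝ) :
    Ψ t x = Phi θ σ t x := by
  obtain ⟨H0, Hadd, Hout, Hbij, Hd, Hc, Hp, Hu⟩ := hΨ
  have hcomm : ∀ t x, Ψ t (f x) = f (Ψ t x) := by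
    intro t x
    rw [← hΨf, ← hΨf, ← Hadd, ← Hadd, add_comm]
  have hIco0 : (0:ℝ) ∈ Ico (0:ℝ) 1 := by simp
  have hz : ∀ t, Ψ t 0 = 0 := by
    intro t
    have h1 := hcomm t 0
    rw [hf0] at h1
    have h2 := (Hbij t).mapsTo hIco0
    by_contra hne
    have h3 := h.lt (Ψ t 0) ⟨lt_of_le_of_ne h2.1 (Ne.symm hne), h2.2⟩
    linarith
  have hmem : ∀ t, ∀ x ∈ Ioo (0:ℝ) 1, Ψ t x ∈ Ioo (0:ℝ) 1 := by
    intro t x hx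
    have h2 := (Hbij t).mapsTo (Ioo_subset_Ico_self hx)
    refine ⟨lt_of_le_of_ne h2.1 fun h3 => ?_, h2.2⟩
    have := (Hbij t).injOn hIco0 (Ioo_subset_Ico_self hx) ((hz t).trans h3)
    exact hx.1.ne this
  have hder : ∀ t, ∀ x ∈ Ioo (0:ℝ) 1, HasDerivAt (Ψ t) (Ψ' t x) x := fun t x hx =>
    (Hd t x (Ioo_subset_Ico_self hx)).hasDerivAt (Ico_mem_nhds hx.1 hx.2)
  have hle : 𝓝[>] (0:ℝ) ≤ 𝓝[Ico (0:ℝ) 1] 0 := by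
    rw [← nhdsWithin_Ioo_eq_nhdsGT (zero_lt_one' ℝ)]
    exact nhdsWithin_mono _ Ioo_subset_Ico_self
  have hconst : ∀ t, ∀ x ∈ Ioo (0:ℝ) 1, ∀ y ∈ Ioo (0:ℝ) 1,
      θ (Ψ t x) - θ x = θ (Ψ t y) - θ y := by
    intro t x hx y hy
    refine h.commute_const (Hp t 0 hIco0) (hmem t) (fun x _ => hcomm t x) (hder t)
      (fun x hx => Hp t x (Ioo_subset_Ico_self hx)) ?_ ((Hc t 0 hIco0).tendsto.mono_left hle) hx hy
    refine tendsto_nhdsWithin_iff.2 ⟨?_, ?_⟩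
    · have := (Hd t 0 hIco0).continuousWithinAt.tendsto.mono_left hle
      rwa [hz] at this
    · filter_upwards [Ioo_mem_nhdsGT (zero_lt_one' ℝ)] with x hx using (hmem t x hx).1
  by_cases hx : x ∈ Ioo (0:ℝ) 1
  · let s : ℝ →+ ℝ :=
      { toFun := fun t => θ (Ψ t x) - θ x
        map_zero' := by rw [H0]; ring
        map_add' := by
          intro a b
          rw [Hadd, ← hconst a _ (hmem b x hx) x hx]; ring }
    have hs : Continuous s := by
      have hΨc : Continuous (fun t => Ψ t x) := by
        rw [Metric.continuous_iff]
        intro t₀ ε hε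
        obtain ⟨δ, hδ, hh⟩ := Hu t₀ {x} isCompact_singleton
          (singleton_subset_iff.2 (Ioo_subset_Ico_self hx)) ε hε
        refine ⟨δ, hδ, fun t ht => ?_⟩
        have := hh t ht x rfl
        rw [Real.dist_eq]
        linarith [abs_nonneg (Real.log (Ψ' t x) - Real.log (Ψ' t₀ x))]
      have : Continuous fun t => θ (Ψ t x) - θ x :=
        (h.θcont.comp_continuous hΨc fun t => hmem t x hx).sub continuous_const
      exact this
    have hlin : s t = t * s 1 := by
      have := map_real_smul s hs t 1
      simpa using this
    have hs1 : s 1 = -1 := by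
      change θ (Ψ 1 x) - θ x = -1
      rw [hΨf, h.θf x hx]; ring
    have hst : θ (Ψ t x) - θ x = -t := by
      change s t = -t
      rw [hlin, hs1]; ring
    rw [Phi_mem hx, ← h.σθ (hmem t x hx)]
    congr 1; linarith
  · rw [Phi_not hx]
    by_cases hx0 : x = 0
    · rw [hx0, hz]
    · refine Hout t x fun hx' => hx ⟨lt_of_le_of_ne hx'.1 (Ne.symm hx0), hx'.2⟩

end SzFlow

theorem le_iSup_Icc {g : ℝ → ℝ} (hg : ContinuousOn g (Icc (0:ℝ) 1)) (x : ℝ)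
    (hx : x ∈ Ico (0:ℝ) 1) : g x ≤ ⨆ x : Icc (0:ℝ) 1, g (x : ℝ) := by
  have hb := (isCompact_Icc.image_of_continuousOn hg).bddAbove
  refine le_ciSup (f := fun x : Icc (0:ℝ) 1 => g (x : ℝ)) ?_ ⟨x, Ico_subset_Icc_self hx⟩
  refine hb.mono ?_
  rintro _ ⟨y, rfl⟩
  exact ⟨y, y.2, rfl⟩

namespace SzFlow

open SzHyp

variable {f f' W θ σ : ℝ → ℝ} {T : ℝ}

theorem expS (h : SzFlow f f' W T θ σ) (hW : ∀ y ∈ Ioo (0:ℝ) 1, W y ≤ 1/2) {x : ℝ}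
    (hx : x ∈ Ioo (0:ℝ) 1) : 1/2 ≤ Real.exp (S f f' x) ∧ Real.exp (S f f' x) ≤ 2 := by
  have h1 := abs_le.1 ((h.S_bound hx).trans (hW x hx))
  constructor
  · linarith [Real.add_one_le_exp (S f f' x), h1.1]
  · have h2 : Real.exp (S f f' x) * Real.exp (-S f f' x) = 1 := by
      rw [← Real.exp_add, add_neg_cancel, Real.exp_zero]
    nlinarith [Real.add_one_le_exp (-S f f' x), h1.2, Real.exp_pos (S f f' x)]

theorem T_le (h : SzFlow f f' W T θ σ) (he : ∀ x ∈ Ioo (0:ℝ) 1, |f' x - 1| ≤ 1/2)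
    (hW : ∀ y ∈ Ioo (0:ℝ) 1, W y ≤ 1/2) : T ≤ 4 := by
  obtain ⟨x, hx⟩ : (Ioo (0:ℝ) 1).Nonempty := ⟨1/2, by norm_num, by norm_num⟩
  have hfx := h.maps x hx
  have hm : ∀ z ∈ Icc (f x) x, z ∈ Ioo (0:ℝ) 1 := fun z hz =>
    ⟨hfx.1.trans_le hz.1, hz.2.trans_lt hx.2⟩
  obtain ⟨c, hc, hc'⟩ := exists_hasDerivAt_eq_slope θ (fun x => 1 / (T * X0 f f' x)) (h.lt x hx)
    (fun z hz => (h.dθ z (hm z hz)).continuousAt.continuousWithinAt)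
    (fun z hz => h.dθ z (hm z ⟨hz.1.le, hz.2.le⟩))
  have hcm := hm c ⟨hc.1.le, hc.2.le⟩
  have hp := sub_pos.2 (h.lt x hx)
  have hpc := sub_pos.2 (h.lt c hcm)
  have hT := h.Tpos
  rw [h.θf x hx, sub_sub_cancel, div_eq_div_iff (mul_pos hT (h.X0_pos hcm)).ne' hp.ne', X0] at hc'
  obtain ⟨d, hd, hd'⟩ := h.mvt hcm.1 hc.2 hx.2
  have hdm := hm d ⟨hc.1.le.trans hd.1.le, hd.2.le⟩
  have h1 := abs_le.1 (he d hdm)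
  have h2 := (h.expS hW hcm).1
  have h3 : (x - f x) ≤ 2 * (c - f c) := by nlinarith [hc.1, hc.2, h1.1]
  have h4 : T * (c - f c) * (1/2) ≤ T * (c - f c) * Real.exp (S f f' c) :=
    mul_le_mul_of_nonneg_left h2 (mul_pos hT hpc).le
  have h5 : T * (c - f c) ≤ 4 * (c - f c) := by nlinarith
  exact le_of_mul_le_mul_right h5 hpc

end SzFlow

/-- **A variation of Szekeres' theorem.** Every `C^{1+bv}` contraction `f` of `[0,1)` is the
time-1 map of a unique `C¹` contracting flow `Φ`. Moreover, there are universal constants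
`C, δ > 0` such that if `f` extends to a `C^{1+bv}` diffeomorphism of `[0,1]` with
`‖f - id‖₁ + var(log Df) ≤ δ`, then
`‖(d/dt)|₀ fᵗ‖_∞ + max_{t ∈ [-1,1]} ‖log Dfᵗ‖_∞ ≤ C (‖f - id‖₁ + var(log Df))`. -/
theorem szekeres_C1bv_variation :
    ∃ C > (0:ℝ), ∃ δ > (0:ℝ), ∀ f f' : ℝ → ℝ,
      -- `f` is a `C¹` diffeomorphism of `[0,1)`, extended by the identity
      f 0 = 0 → (∀ x : ℝ, x ∉ Ico (0:ℝ) 1 → f x = x) →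
      BijOn f (Ico (0:ℝ) 1) (Ico (0:ℝ) 1) →
      (∀ x ∈ Ico (0:ℝ) 1, HasDerivWithinAt f (f' x) (Ico (0:ℝ) 1) x) →
      ContinuousOn f' (Ico (0:ℝ) 1) → (∀ x ∈ Ico (0:ℝ) 1, 0 < f' x) →
      -- `f` is a contraction
      (∀ x ∈ Ioo (0:ℝ) 1, f x < x) →
      -- `log Df` has finite total variation on `[0,1)`
      BoundedVariationOn (fun x => Real.log (f' x)) (Ico (0:ℝ) 1) →
      ∃ Φ Φ' : ℝ → ℝ → ℝ,
        IsC1FlowOn (Ico (0:ℝ) 1) Φ Φ' ∧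
        -- the flow is contracting
        (∀ t > (0:ℝ), ∀ x ∈ Ioo (0:ℝ) 1, Φ t x < x) ∧
        -- `f` is its time-1 map
        (∀ x : ℝ, Φ 1 x = f x) ∧
        -- uniqueness of the `C¹` contracting flow with time-1 map `f`
        (∀ Ψ Ψ' : ℝ → ℝ → ℝ, IsC1FlowOn (Ico (0:ℝ) 1) Ψ Ψ' →
          (∀ t > (0:ℝ), ∀ x ∈ Ioo (0:ℝ) 1, Ψ t x < x) → (∀ x : ℝ, Ψ 1 x = f x) →
          ∀ t x : ℝ, Ψ t x = Φ t x) ∧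
        -- the quantitative estimate, when `f` is `C^{1+bv}` on the closed interval `[0,1]`
        ((∀ x ∈ Icc (0:ℝ) 1, HasDerivWithinAt f (f' x) (Icc (0:ℝ) 1) x) →
          ContinuousOn f' (Icc (0:ℝ) 1) →
          BoundedVariationOn (fun x => Real.log (f' x)) (Icc (0:ℝ) 1) →
          ((⨆ x : Icc (0:ℝ) 1, |f (x : ℝ) - (x : ℝ)|) +
            (⨆ x : Icc (0:ℝ) 1, |f' (x : ℝ) - 1|) +
            (eVariationOn (fun y => Real.log (f' y)) (Icc (0:ℝ) 1)).toReal ≤ δ) →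
          ∀ X : ℝ → ℝ, (∀ x ∈ Ico (0:ℝ) 1, HasDerivAt (fun t => Φ t x) (X x) 0) →
            ∀ t ∈ Icc (-1:ℝ) 1, ∀ x ∈ Ico (0:ℝ) 1,
              |X x| + |Real.log (Φ' t x)| ≤
                C * ((⨆ x : Icc (0:ℝ) 1, |f (x : ℝ) - (x : ℝ)|) +
                  (⨆ x : Icc (0:ℝ) 1, |f' (x : ℝ) - 1|) +
                  (eVariationOn (fun y => Real.log (f' y)) (Icc (0:ℝ) 1)).toReal)) := by
  refine ⟨16, by norm_num, 1/2, by norm_num, ?_⟩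
  intro f f' hf0 hout hbij hder hcont hpos hlt hbv
  obtain ⟨W, hW1, hW2, hW3⟩ := exists_W _ hbv
  have hI0 : (0:ℝ) ∈ Ico (0:ℝ) 1 := by simp
  have hsub : Ioo (0:ℝ) 1 ⊆ Ico (0:ℝ) 1 := Ioo_subset_Ico_self
  have hyp : SzHyp f f' W := by
    refine ⟨?_, ?_, hlt, ?_, fun x hx => hpos x (hsub hx), hcont.mono hsub, hW1, hW2⟩
    · intro x hx
      have h2 := hbij.mapsTo (hsub hx)
      refine ⟨lt_of_le_of_ne h2.1 fun h3 => ?_, h2.2⟩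
      exact hx.1.ne (hbij.injOn hI0 (hsub hx) (hf0.trans h3))
    · intro y hy
      obtain ⟨x, hx, rfl⟩ := hbij.surjOn (hsub hy)
      refine ⟨x, ⟨lt_of_le_of_ne hx.1 ?_, hx.2⟩, rfl⟩
      rintro rfl
      rw [hf0] at hy
      exact lt_irrefl _ hy.1
    · exact fun x hx => (hder x (hsub hx)).hasDerivAt (Ico_mem_nhds hx.1 hx.2)
  obtain ⟨T, θ, σ, h⟩ := hyp.exists_flow
  have hl : Tendsto f' (𝓝[>] 0) (𝓝 (f' 0)) := by
    rw [← nhdsWithin_Ioo_eq_nhdsGT (zero_lt_one' ℝ)]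
    exact (hcont 0 hI0).tendsto.mono_left (nhdsWithin_mono _ hsub)
  refine ⟨SzFlow.Phi θ σ, fun t x => Real.exp (SzFlow.L f f' θ σ ((1 - f' 0) * T) t x),
    h.isFlow hl, ?_, ?_, ?_, ?_⟩
  · intro t ht x hx
    rw [SzFlow.Phi_mem hx]
    conv_rhs => rw [← h.σθ hx]
    exact h.σmono (by linarith)
  · intro x
    by_cases hx : x ∈ Ioo (0:ℝ) 1
    · rw [SzFlow.Phi_mem hx, h.f_eq hx]
    · rw [SzFlow.Phi_not hx]
      by_cases hx0 : x = 0
      · rw [hx0, hf0]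
      · exact (hout x fun hx' => hx ⟨lt_of_le_of_ne hx'.1 (Ne.symm hx0), hx'.2⟩).symm
  · intro Ψ Ψ' hΨ _ hΨf t x
    exact h.uniq hf0 hΨ hΨf t x
  · intro hd1 hc1 hbv1 hsmall X hX t ht x hx
    set a := ⨆ x : Icc (0:ℝ) 1, |f (x : ℝ) - (x : ℝ)| with ha
    set e := ⨆ x : Icc (0:ℝ) 1, |f' (x : ℝ) - 1| with he
    set V := (eVariationOn (fun y => Real.log (f' y)) (Icc (0:ℝ) 1)).toReal with hV
    have hfc : ContinuousOn f (Icc (0:ℝ) 1) := fun x hx => (hd1 x hx).continuousWithinAt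
    have hale : ∀ x ∈ Ico (0:ℝ) 1, |f x - x| ≤ a := fun x hx =>
      le_iSup_Icc (g := fun x => |f x - x|) (hfc.sub continuousOn_id).abs x hx
    have hele : ∀ x ∈ Ico (0:ℝ) 1, |f' x - 1| ≤ e := fun x hx =>
      le_iSup_Icc (g := fun x => |f' x - 1|) (hc1.sub continuousOn_const).abs x hx
    have hWV : ∀ y ∈ Ioo (0:ℝ) 1, W y ≤ V := fun y hy => (hW3 y hy).trans
      (ENNReal.toReal_mono hbv1 (eVariationOn.mono _ Ico_subset_Icc_self))
    have ha0 : 0 ≤ a := (abs_nonneg _).trans (hale 0 hI0)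
    have he0 : 0 ≤ e := (abs_nonneg _).trans (hele 0 hI0)
    have hV0 : 0 ≤ V := ENNReal.toReal_nonneg
    have hW' : ∀ y ∈ Ioo (0:ℝ) 1, W y ≤ 1/2 := fun y hy => (hWV y hy).trans (by linarith)
    have hT : T ≤ 4 := h.T_le (fun x hx => (hele x (hsub hx)).trans (by linarith)) hW'
    have hTp := h.Tpos
    have ht1 : |t| ≤ 1 := abs_le.2 ht
    have hTE : ∀ y ∈ Ioo (0:ℝ) 1, T * Real.exp (SzHyp.S f f' y) ≤ 8 := by
      intro y hy
      have := (h.expS hW' hy).2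
      nlinarith [Real.exp_pos (SzHyp.S f f' y)]
    rw [Real.log_exp]
    by_cases hx' : x ∈ Ioo (0:ℝ) 1
    · have hXx : X x = -(T * SzHyp.X0 f f' x) := by
        have h1 : HasDerivAt (fun t => σ (θ x - t)) _ 0 :=
          (h.dσ (θ x - 0)).comp_const_sub (θ x) 0
        rw [sub_zero, h.σθ hx'] at h1
        refine (hX x hx).unique (h1.congr_of_eventuallyEq ?_)
        exact Eventually.of_forall fun t => SzFlow.Phi_mem hx'
      have hX1 : |X x| ≤ 8 * a := by
        rw [hXx, abs_neg, SzHyp.X0, ← mul_assoc, abs_mul, abs_sub_comm,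
          abs_of_pos (mul_pos hTp (Real.exp_pos _))]
        exact mul_le_mul (hTE x hx') (hale x hx) (abs_nonneg _) (by norm_num)
      obtain ⟨c, hc, hc'⟩ := h.ell_eq hx' t
      rw [SzFlow.L_mem hx', hc']
      have b1 := (h.S_bound (h.σmem (θ x - t))).trans (hWV _ (h.σmem _))
      have b2 := (h.S_bound hx').trans (hWV _ hx')
      have b3 : |t * SzFlow.A f f' T (σ (θ x - c))| ≤ e * 8 := by
        rw [abs_mul]
        have hy := h.σmem (θ x - c)
        have : |SzFlow.A f f' T (σ (θ x - c))| ≤ e * 8 := by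
          rw [SzFlow.A, abs_mul, abs_sub_comm, abs_of_pos (mul_pos hTp (Real.exp_pos _))]
          exact mul_le_mul (hele _ (hsub hy)) (hTE _ hy)
            (mul_pos hTp (Real.exp_pos _)).le he0
        calc |t| * |SzFlow.A f f' T (σ (θ x - c))| ≤ 1 * (e * 8) :=
              mul_le_mul ht1 this (abs_nonneg _) (by norm_num)
          _ = e * 8 := one_mul _
      have b4 := abs_sub (SzHyp.S f f' (σ (θ x - t)) - SzHyp.S f f' x)
        (t * SzFlow.A f f' T (σ (θ x - c)))
      have b5 := abs_sub (SzHyp.S f f' (σ (θ x - t))) (SzHyp.S f f' x)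
      linarith
    · have hx0 : x = 0 := by
        by_contra hne
        exact hx' ⟨lt_of_le_of_ne hx.1 (Ne.symm hne), hx.2⟩
      have hXx : X x = 0 := by
        refine (hX x hx).unique ((hasDerivAt_const (0:ℝ) x).congr_of_eventuallyEq ?_)
        exact Eventually.of_forall fun t => SzFlow.Phi_not hx'
      rw [hXx, abs_zero, SzFlow.L_not hx', abs_mul, abs_neg, abs_mul, abs_of_pos hTp,
        abs_sub_comm]
      have b1 : |f' 0 - 1| * T ≤ e * 4 := mul_le_mul (hele 0 hI0) hT hTp.le he0
      have b2 : |f' 0 - 1| * T * |t| ≤ e * 4 * 1 := mul_le_mul b1 ht1 (abs_nonneg _) (by positivity)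
      linarith
end
end

section
/- Let f be a C^{1+bv} diffeomorphism of [0,1] with f(x) ≠ x for every x ∈ (0,1). Then its Mather invariant M_f is a C^{1+bv} diffeomorphism, and |var(log DM_f) − V_∞(f)| ≤ |log Df(0)| + |log Df(1)|. -/
open Set MeasureTheory Filter Topology

noncomputable section

/-- An orientation-preserving `C¹` diffeomorphism of the interval `[0,1]`, recorded together
with its derivative, and extended by the identity outside of `[0,1]`. -/
structure C1Diffeo : Type where
  toFun : ℝ → ℝ
  derivFun : ℝ → ℝ
  map_zero : toFun 0 = 0
  map_one : toFun 1 = 1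
  fixes_outside : ∀ x : ℝ, x ∉ Icc (0:ℝ) 1 → toFun x = x
  bijOn : BijOn toFun (Icc (0:ℝ) 1) (Icc (0:ℝ) 1)
  hasDeriv : ∀ x ∈ Icc (0:ℝ) 1, HasDerivWithinAt toFun (derivFun x) (Icc (0:ℝ) 1) x
  derivFun_cont : ContinuousOn derivFun (Icc (0:ℝ) 1)
  derivFun_pos : ∀ x ∈ Icc (0:ℝ) 1, 0 < derivFun x

/-- A `C^{1+bv}` diffeomorphism of `[0,1]`: a `C¹` diffeomorphism such that `log Df` has
finite total variation. -/
structure C1bvDiffeo extends C1Diffeo where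
  logDeriv_bv : BoundedVariationOn (fun x => Real.log (derivFun x)) (Icc (0:ℝ) 1)

/-- An action of `ℤᵈ` on `[0,1]` by orientation-preserving `C^{1+bv}` diffeomorphisms. -/
structure ZdAction1bv (d : ℕ) where
  elt : (Fin d → ℤ) → C1bvDiffeo
  elt_add : ∀ a b : Fin d → ℤ, ∀ x : ℝ,
    (elt (a + b)).toFun x = (elt a).toFun ((elt b).toFun x)
  elt_zero : ∀ x : ℝ, (elt 0).toFun x = x

/-- `log D(fⁿ)`, computed via the chain rule: `log D(fⁿ)(x) = ∑_{k<n} log Df(fᵏ(x))`. -/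
def logDIter (f : C1bvDiffeo) (n : ℕ) (x : ℝ) : ℝ :=
  ∑ k ∈ Finset.range n, Real.log (f.derivFun (f.toFun^[k] x))

/-- `var (log D(fⁿ))` over `[0,1]`. -/
def varLogDIter (f : C1bvDiffeo) (n : ℕ) : ℝ :=
  (eVariationOn (logDIter f n) (Icc (0:ℝ) 1)).toReal

/-! ### Variation lemmas -/

/-- Triangle inequality for variations. -/
lemma eVar_le_add {f g h : ℝ → ℝ} {s : Set ℝ}
    (H : ∀ x ∈ s, ∀ y ∈ s, |f x - f y| ≤ |g x - g y| + |h x - h y|) :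
    eVariationOn f s ≤ eVariationOn g s + eVariationOn h s := by
  refine iSup_le ?_
  rintro ⟨n, u, hu, us⟩
  calc ∑ i ∈ Finset.range n, edist (f (u (i + 1))) (f (u i))
      ≤ ∑ i ∈ Finset.range n,
          (edist (g (u (i + 1))) (g (u i)) + edist (h (u (i + 1))) (h (u i))) := by
        refine Finset.sum_le_sum fun i _ => ?_
        rw [edist_dist, edist_dist, edist_dist, ← ENNReal.ofReal_add dist_nonneg dist_nonneg]
        refine ENNReal.ofReal_le_ofReal ?_
        simpa [Real.dist_eq] using H _ (us (i + 1)) _ (us i)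
    _ ≤ _ := by
        rw [Finset.sum_add_distrib]
        exact add_le_add (eVariationOn.sum_le hu us) (eVariationOn.sum_le hu us)

lemma eVar_le {f g : ℝ → ℝ} {s : Set ℝ}
    (H : ∀ x ∈ s, ∀ y ∈ s, |f x - f y| ≤ |g x - g y|) :
    eVariationOn f s ≤ eVariationOn g s := by
  have := eVar_le_add (f := f) (g := g) (h := fun _ => 0) (s := s) (by simpa using H)
  have h0 : eVariationOn (fun _ : ℝ => (0:ℝ)) s = 0 :=
    eVariationOn.constant_on (by
      rintro a ⟨x, _, rfl⟩ b ⟨y, _, rfl⟩; rfl)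
  simpa [h0] using this

lemma eVar_sum_le (F : ℕ → ℝ → ℝ) (s : Set ℝ) (n : ℕ) :
    eVariationOn (fun x => ∑ k ∈ Finset.range n, F k x) s
      ≤ ∑ k ∈ Finset.range n, eVariationOn (F k) s := by
  induction n with
  | zero =>
    simp only [Finset.range_zero, Finset.sum_empty]
    rw [eVariationOn.constant_on]
    rintro a ⟨x, _, rfl⟩ b ⟨y, _, rfl⟩; rfl
  | succ n ih =>
    rw [Finset.sum_range_succ]
    refine le_trans (eVar_le_add (g := fun x => ∑ k ∈ Finset.range n, F k x) (h := F n) ?_)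
      (add_le_add_left ih _)
    intro x _ y _
    simp only [Finset.sum_range_succ]
    rw [add_sub_add_comm]
    exact abs_add_le _ _

lemma eVar_anti_sum_le (g : ℝ → ℝ) {c : ℕ → ℝ} (hc : Antitone c) (n : ℕ) :
    ∑ k ∈ Finset.range n, eVariationOn g (Icc (c (k + 1)) (c k))
      ≤ eVariationOn g (Icc (c n) (c 0)) := by
  induction n with
  | zero => simp
  | succ n ih =>
    rw [Finset.sum_range_succ]
    have := eVariationOn.Icc_add_Icc g (s := univ) (hc (Nat.le_succ n)) (hc (Nat.zero_le n))
      (mem_univ _)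
    simp only [univ_inter] at this
    rw [← this, add_comm]
    gcongr

lemma eVar_linear (c : ℝ) :
    eVariationOn (fun t : ℝ => t * c) (Icc (0:ℝ) 1) ≤ ENNReal.ofReal |c| := by
  have h1 : eVariationOn (fun t : ℝ => t * c) (Icc (0:ℝ) 1)
      ≤ eVariationOn (fun t : ℝ => t * |c|) (Icc (0:ℝ) 1) := by
    refine eVar_le fun x _ y _ => ?_
    rw [← sub_mul, ← sub_mul, abs_mul, abs_mul, abs_abs]
  refine h1.trans ?_
  have hm : MonotoneOn (fun t : ℝ => t * |c|) (Icc (0:ℝ) 1) := fun x _ y _ hxy =>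
    mul_le_mul_of_nonneg_right hxy (abs_nonneg c)
  have := (hm.eVariationOn_eq (a := 0) (b := 1) (by simp) (by simp)).le
  simpa using this

/-- Lower semicontinuity in inequality form. -/
lemma eVar_le_of_tendsto {F : ℕ → ℝ → ℝ} {f : ℝ → ℝ} {s : Set ℝ} {v : ENNReal}
    (h : ∀ x ∈ s, Tendsto (fun i => F i x) atTop (𝓝 (f x)))
    (hv : ∀ i, eVariationOn (F i) s ≤ v) : eVariationOn f s ≤ v := by
  by_contra hlt
  push Not at hlt
  obtain ⟨i, hi⟩ := (eVariationOn.lowerSemicontinuous_aux h hlt).exists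
  exact absurd hi (not_lt.2 (hv i))

/-! ### A division lemma for derivatives -/

lemma hasDerivAt_of_comp {A g : ℝ → ℝ} {a h t₀ : ℝ} (hg : ContinuousAt g t₀)
    (hA : HasDerivAt A a (g t₀)) (ha : a ≠ 0)
    (hH : HasDerivAt (fun t => A (g t)) h t₀) : HasDerivAt g (h / a) t₀ := by
  have hd : ContinuousAt (fun t => dslope A (g t₀) (g t)) t₀ := by
    have := continuousAt_dslope_same.2 hA.differentiableAt
    exact ContinuousAt.comp (f := g) (g := dslope A (g t₀)) this hg
  have hval : dslope A (g t₀) (g t₀) = a := by rw [dslope_same, hA.deriv]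
  rw [hasDerivAt_iff_tendsto_slope] at hH ⊢
  have hd' : Tendsto (fun t => dslope A (g t₀) (g t)) (𝓝[≠] t₀) (𝓝 a) := by
    have := hd.tendsto
    simp only [hval] at this
    exact this.mono_left nhdsWithin_le_nhds
  refine (hH.div hd' ha).congr' ?_
  have hne : ∀ᶠ t in 𝓝[≠] t₀, dslope A (g t₀) (g t) ≠ 0 := hd'.eventually_ne ha
  filter_upwards [hne] with t ht
  have := sub_smul_dslope A (g t₀) (g t)
  simp only [smul_eq_mul] at this
  simp only [slope_def_field, Pi.div_apply]
  rw [← this]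
  field_simp

/-! ### Flow basics -/

section flow

variable {s : Set ℝ} {Φ Φ' : ℝ → ℝ → ℝ}

lemma IsC1FlowOn.rev (h : IsC1FlowOn s Φ Φ') :
    IsC1FlowOn s (fun t => Φ (-t)) (fun t => Φ' (-t)) := by
  obtain ⟨h0, hadd, hout, hbij, hder, hcont, hpos, htop⟩ := h
  refine ⟨fun x => by simp [h0], fun t u x => ?_, fun t => hout _, fun t => hbij _, fun t => hder _,
    fun t => hcont _, fun t => hpos _, fun t₀ K hK hKs ε hε => ?_⟩
  · change Φ (-(t + u)) x = Φ (-t) (Φ (-u) x)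
    rw [neg_add]; exact hadd _ _ _
  · obtain ⟨δ, hδ, H⟩ := htop (-t₀) K hK hKs ε hε
    refine ⟨δ, hδ, fun t ht x hx => H (-t) ?_ x hx⟩
    rwa [neg_sub_neg, abs_sub_comm]

lemma IsC1FlowOn.mem (h : IsC1FlowOn s Φ Φ') (t : ℝ) {x : ℝ} (hx : x ∈ s) : Φ t x ∈ s :=
  (h.2.2.2.1 t).mapsTo hx

lemma IsC1FlowOn.neg_cancel (h : IsC1FlowOn s Φ Φ') (t x : ℝ) : Φ (-t) (Φ t x) = x := by
  rw [← h.2.1]; simp [h.1]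

lemma IsC1FlowOn.cancel_neg (h : IsC1FlowOn s Φ Φ') (t x : ℝ) : Φ t (Φ (-t) x) = x := by
  rw [← h.2.1]; simp [h.1]

lemma IsC1FlowOn.comm (h : IsC1FlowOn s Φ Φ') (t u x : ℝ) : Φ t (Φ u x) = Φ u (Φ t x) := by
  rw [← h.2.1, ← h.2.1, add_comm]

lemma IsC1FlowOn.chain (h : IsC1FlowOn s Φ Φ') (hs : UniqueDiffOn ℝ s) (t u : ℝ) {x : ℝ}
    (hx : x ∈ s) : Φ' (t + u) x = Φ' t (Φ u x) * Φ' u x := by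
  have h1 := h.2.2.2.2.1 (t + u) x hx
  have h2 := (h.2.2.2.2.1 t _ (h.mem u hx)).comp x (h.2.2.2.2.1 u x hx) (h.2.2.2.1 u).mapsTo
  have h3 : (Φ t ∘ Φ u) = Φ (t + u) := by ext y; exact (h.2.1 t u y).symm
  rw [h3] at h2
  exact (hs x hx).eq_deriv _ h1 h2

lemma IsC1FlowOn.logchain (h : IsC1FlowOn s Φ Φ') (hs : UniqueDiffOn ℝ s) (t u : ℝ) {x : ℝ}
    (hx : x ∈ s) :
    Real.log (Φ' (t + u) x) = Real.log (Φ' t (Φ u x)) + Real.log (Φ' u x) := by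
  rw [h.chain hs t u hx, Real.log_mul]
  · exact (h.2.2.2.2.2.2.1 _ _ (h.mem u hx)).ne'
  · exact (h.2.2.2.2.2.2.1 _ _ hx).ne'

lemma IsC1FlowOn.cocycle (h : IsC1FlowOn s Φ Φ') (hs : UniqueDiffOn ℝ s) (t u : ℝ) {x : ℝ}
    (hx : x ∈ s) :
    Real.log (Φ' t (Φ u x)) + Real.log (Φ' u x)
      = Real.log (Φ' u (Φ t x)) + Real.log (Φ' t x) := by
  rw [← h.logchain hs t u hx, ← h.logchain hs u t hx, add_comm]

lemma IsC1FlowOn.log_zero (h : IsC1FlowOn s Φ Φ') (hs : UniqueDiffOn ℝ s) {x : ℝ}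
    (hx : x ∈ s) : Real.log (Φ' 0 x) = 0 := by
  have := h.logchain hs 0 0 hx
  rw [h.1, add_zero] at this
  linarith

lemma IsC1FlowOn.strictMonoOn (h : IsC1FlowOn s Φ Φ') (hs : Convex ℝ s) (t : ℝ) :
    StrictMonoOn (Φ t) s := by
  refine strictMonoOn_of_hasDerivWithinAt_pos (f' := Φ' t) hs
    (fun x hx => (h.2.2.2.2.1 t x hx).continuousWithinAt) ?_ ?_
  · intro x hx
    exact (h.2.2.2.2.1 t x (interior_subset hx)).mono interior_subset
  · intro x hx
    exact h.2.2.2.2.2.2.1 t x (interior_subset hx)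

lemma IsC1FlowOn.continuous_time (h : IsC1FlowOn s Φ Φ') {x : ℝ} (hx : x ∈ s) :
    Continuous (fun t => Φ t x) := by
  rw [Metric.continuous_iff]
  intro t₀ ε hε
  obtain ⟨δ, hδ, H⟩ := h.2.2.2.2.2.2.2 t₀ {x} isCompact_singleton (by simpa using hx) ε hε
  refine ⟨δ, hδ, fun t ht => ?_⟩
  have := H t (by simpa [Real.dist_eq] using ht) x rfl
  rw [Real.dist_eq]
  linarith [abs_nonneg (Real.log (Φ' t x) - Real.log (Φ' t₀ x))]

lemma IsC1FlowOn.continuous_log (h : IsC1FlowOn s Φ Φ') {x : ℝ} (hx : x ∈ s) :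
    Continuous (fun t => Real.log (Φ' t x)) := by
  rw [Metric.continuous_iff]
  intro t₀ ε hε
  obtain ⟨δ, hδ, H⟩ := h.2.2.2.2.2.2.2 t₀ {x} isCompact_singleton (by simpa using hx) ε hε
  refine ⟨δ, hδ, fun t ht => ?_⟩
  have := H t (by simpa [Real.dist_eq] using ht) x rfl
  rw [Real.dist_eq]
  linarith [abs_nonneg (Φ t x - Φ t₀ x)]

lemma IsC1FlowOn.continuous_deriv (h : IsC1FlowOn s Φ Φ') {x : ℝ} (hx : x ∈ s) :
    Continuous (fun t => Φ' t x) := by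
  have : (fun t => Φ' t x) = fun t => Real.exp (Real.log (Φ' t x)) := by
    ext t; rw [Real.exp_log (h.2.2.2.2.2.2.1 t x hx)]
  rw [this]
  exact Real.continuous_exp.comp (h.continuous_log hx)

lemma IsC1FlowOn.bound (h : IsC1FlowOn s Φ Φ') {K : Set ℝ} (hK : IsCompact K) (hKs : K ⊆ s) :
    ∃ B : ℝ, ∀ t ∈ Icc (0:ℝ) 1, ∀ x ∈ K, |Φ' t x| ≤ B := by
  refine isCompact_Icc.induction_on (p := fun S => ∃ B : ℝ, ∀ t ∈ S, ∀ x ∈ K, |Φ' t x| ≤ B)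
    ⟨0, by simp⟩ ?_ ?_ ?_
  · rintro S T hST ⟨B, hB⟩
    exact ⟨B, fun t ht => hB t (hST ht)⟩
  · rintro S T ⟨B, hB⟩ ⟨C, hC⟩
    refine ⟨max B C, ?_⟩
    rintro t (ht | ht) x hx
    · exact (hB t ht x hx).trans (le_max_left _ _)
    · exact (hC t ht x hx).trans (le_max_right _ _)
  · intro t₀ _
    obtain ⟨δ, hδ, H⟩ := h.2.2.2.2.2.2.2 t₀ K hK hKs 1 one_pos
    have hc : ContinuousOn (fun x => Real.log (Φ' t₀ x)) K :=
      ((h.2.2.2.2.2.1 t₀).mono hKs).log fun x hx => (h.2.2.2.2.2.2.1 t₀ x (hKs hx)).ne'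
    obtain ⟨B, hB⟩ := hK.exists_bound_of_continuousOn hc
    refine ⟨Metric.ball t₀ δ, mem_nhdsWithin_of_mem_nhds (Metric.ball_mem_nhds _ hδ),
      Real.exp (B + 1), fun t ht x hx => ?_⟩
    have h1 := H t (by simpa [Real.dist_eq] using ht) x hx
    have h2 := hB x hx
    have h3 := h.2.2.2.2.2.2.1 t x (hKs hx)
    rw [abs_of_pos h3, ← Real.log_le_iff_le_exp h3]
    rw [Real.norm_eq_abs] at h2
    have := abs_nonneg (Φ t x - Φ t₀ x)
    have := le_abs_self (Real.log (Φ' t x) - Real.log (Φ' t₀ x))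
    have := le_abs_self (Real.log (Φ' t₀ x))
    linarith

/-- The orbit map of a `C¹` flow is differentiable in time. -/
lemma IsC1FlowOn.time_deriv (h : IsC1FlowOn s Φ Φ') {x : ℝ} (hx : s ∈ 𝓝 x) :
    ∃ a : ℝ, 0 < a ∧ ∀ t, HasDerivAt (fun t => Φ t x) (Φ' t x * ((Φ 1 x - x) / a)) t := by
  have hxs : x ∈ s := mem_of_mem_nhds hx
  obtain ⟨r, hr, hrs⟩ := Metric.nhds_basis_closedBall.mem_iff.1 hx
  obtain ⟨B, hB⟩ := h.bound (isCompact_closedBall x r) hrs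
  have hball : Metric.ball x r ⊆ s := Metric.ball_subset_closedBall.trans hrs
  have hder : HasDerivAt (fun y => ∫ u in (0:ℝ)..1, Φ u y) (∫ u in (0:ℝ)..1, Φ' u x) x := by
    refine (intervalIntegral.hasDerivAt_integral_of_dominated_loc_of_deriv_le
      (F := fun y u => Φ u y) (F' := fun y u => Φ' u y)
      (bound := fun _ => B) (Metric.ball_mem_nhds x hr) ?_ ?_ ?_ ?_ ?_ ?_).2
    · filter_upwards [hx] with y hy
      exact (h.continuous_time hy).aestronglyMeasurable
    · exact (h.continuous_time hxs).intervalIntegrable _ _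
    · exact (h.continuous_deriv hxs).aestronglyMeasurable
    · refine ae_of_all _ fun u hu y hy => ?_
      rw [uIoc_of_le zero_le_one] at hu
      exact hB u ⟨hu.1.le, hu.2⟩ y (Metric.ball_subset_closedBall hy)
    · exact intervalIntegrable_const
    · refine ae_of_all _ fun u hu y hy => ?_
      exact (h.2.2.2.2.1 u y (hball hy)).hasDerivAt
        (mem_of_superset (Metric.isOpen_ball.mem_nhds hy) hball)
  have hapos : 0 < ∫ u in (0:ℝ)..1, Φ' u x :=
    intervalIntegral.intervalIntegral_pos_of_pos ((h.continuous_deriv hxs).intervalIntegrable _ _)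
      (fun u => h.2.2.2.2.2.2.1 u x hxs) one_pos
  set a := ∫ u in (0:ℝ)..1, Φ' u x with ha
  have hg := h.continuous_time hxs
  have hH : HasDerivAt (fun t => ∫ u in (0:ℝ)..1, Φ u (Φ t x)) (Φ 1 x - x) 0 := by
    have e : (fun t => ∫ u in (0:ℝ)..1, Φ u (Φ t x))
        = fun t => (∫ u in (0:ℝ)..(1 + t), Φ u x) - ∫ u in (0:ℝ)..t, Φ u x := by
      ext t
      rw [intervalIntegral.integral_interval_sub_left (hg.intervalIntegrable _ _)
        (hg.intervalIntegrable _ _)]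
      have : ∀ u, Φ u (Φ t x) = Φ (u + t) x := fun u => (h.2.1 u t x).symm
      simp only [this]
      rw [intervalIntegral.integral_comp_add_right (fun u => Φ u x) t, zero_add]
    rw [e]
    have d2 : HasDerivAt (fun t => ∫ u in (0:ℝ)..t, Φ u x) (Φ 0 x) 0 :=
      intervalIntegral.integral_hasDerivAt_right (hg.intervalIntegrable _ _)
        hg.stronglyMeasurable.stronglyMeasurableAtFilter hg.continuousAt
    have d1 : HasDerivAt (fun t => ∫ u in (0:ℝ)..t, Φ u x) (Φ 1 x) (1 + 0) := by
      rw [add_zero]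
      exact intervalIntegral.integral_hasDerivAt_right (hg.intervalIntegrable _ _)
        hg.stronglyMeasurable.stronglyMeasurableAtFilter hg.continuousAt
    have d1' := d1.comp_const_add 1 0
    rw [h.1] at d2
    exact d1'.sub d2
  have hA : HasDerivAt (fun y => ∫ u in (0:ℝ)..1, Φ u y) a (Φ 0 x) := by rw [h.1]; exact hder
  have h0 := hasDerivAt_of_comp (g := fun t => Φ t x) hg.continuousAt hA hapos.ne' hH
  refine ⟨a, hapos, fun t => ?_⟩
  have e : (fun u => Φ u x) = fun u => Φ t (Φ (u - t) x) := by
    ext u; rw [← h.2.1]; congr 1; ring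
  rw [e]
  have h0' : HasDerivAt (fun u => Φ (u - t) x) ((Φ 1 x - x) / a) t := by
    have h0'' : HasDerivAt (fun t => Φ t x) ((Φ 1 x - x) / a) (t - t) := by rwa [sub_self]
    exact h0''.comp_sub_const t t
  have hΦt : HasDerivAt (Φ t) (Φ' t x) (Φ (t - t) x) := by
    rw [sub_self, h.1]
    exact (h.2.2.2.2.1 t x hxs).hasDerivAt hx
  exact hΦt.comp t h0'

lemma IsC1FlowOn.log_fixed (h : IsC1FlowOn s Φ Φ') (hs : UniqueDiffOn ℝ s) {e : ℝ} (he : e ∈ s)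
    (hfix : ∀ t, Φ t e = e) (t : ℝ) : Real.log (Φ' t e) = t * Real.log (Φ' 1 e) := by
  let F : ℝ →+ ℝ :=
    { toFun := fun t => Real.log (Φ' t e)
      map_zero' := h.log_zero hs he
      map_add' := fun t u => by rw [h.logchain hs t u he, hfix] }
  have := map_real_smul F (h.continuous_log he) t 1
  simpa [F] using this

/-- The key estimate near a fixed endpoint. -/
lemma IsC1FlowOn.endpoint (h : IsC1FlowOn s Φ Φ') (hs : UniqueDiffOn ℝ s) {e y : ℝ} (he : e ∈ s)
    (hfix : ∀ t, Φ t e = e) (hy : y ∈ s) (τ : ℕ → ℝ)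
    (hτ : Tendsto (fun n => Φ (τ n) y) atTop (𝓝 e)) {v : ENNReal}
    (hv : ∀ n, eVariationOn (fun t => Real.log (Φ' (τ n) (Φ t y))) (Icc (0:ℝ) 1) ≤ v) :
    eVariationOn (fun t => Real.log (Φ' t y)) (Icc (0:ℝ) 1)
      ≤ ENNReal.ofReal |Real.log (Φ' 1 e)| + v := by
  have key : eVariationOn (fun t => t * Real.log (Φ' 1 e) - Real.log (Φ' t y)) (Icc (0:ℝ) 1)
      ≤ v := by
    refine eVar_le_of_tendsto
      (F := fun n t => Real.log (Φ' (τ n) (Φ t y)) - Real.log (Φ' (τ n) y)) ?_ ?_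
    · intro t _
      have e1 : ∀ n, Real.log (Φ' (τ n) (Φ t y)) - Real.log (Φ' (τ n) y)
          = Real.log (Φ' t (Φ (τ n) y)) - Real.log (Φ' t y) := fun n => by
        have := h.cocycle hs t (τ n) hy
        linarith
      simp only [e1]
      refine Tendsto.sub_const ?_ _
      rw [← h.log_fixed hs he hfix t]
      have hc : ContinuousWithinAt (fun x => Real.log (Φ' t x)) s e :=
        (h.2.2.2.2.2.1 t e he).log (h.2.2.2.2.2.2.1 t e he).ne'
      exact hc.tendsto.comp (tendsto_nhdsWithin_iff.2
        ⟨hτ, Eventually.of_forall fun n => h.mem _ hy⟩)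
    · intro n
      refine le_trans (eVar_le fun a _ b _ => ?_) (hv n)
      simp
  refine le_trans (eVar_le_add (g := fun t => t * Real.log (Φ' 1 e))
    (h := fun t => t * Real.log (Φ' 1 e) - Real.log (Φ' t y)) ?_)
    (add_le_add (eVar_linear _) key)
  intro a _ b _
  rw [show Real.log (Φ' a y) - Real.log (Φ' b y)
    = (a * Real.log (Φ' 1 e) - b * Real.log (Φ' 1 e))
      - ((a * Real.log (Φ' 1 e) - Real.log (Φ' a y))
        - (b * Real.log (Φ' 1 e) - Real.log (Φ' b y))) by ring]
  exact abs_sub _ _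

end flow

/-! ### The setting: a pair of flows with the same time-one map, moving points to the left -/

lemma ico_zero {Φ Φ' : ℝ → ℝ → ℝ} (h : IsC1FlowOn (Ico (0:ℝ) 1) Φ Φ') (t : ℝ) : Φ t 0 = 0 := by
  have h0 : (0:ℝ) ∈ Ico (0:ℝ) 1 := by simp
  obtain ⟨y, hy, hy0⟩ := (h.2.2.2.1 t).surjOn h0
  have h1 := (h.strictMonoOn (convex_Ico 0 1) t).monotoneOn h0 hy hy.1
  exact le_antisymm (h1.trans hy0.le) (h.mem t h0).1

lemma ico_one {Φ Φ' : ℝ → ℝ → ℝ} (h : IsC1FlowOn (Ico (0:ℝ) 1) Φ Φ') (t : ℝ) : Φ t 1 = 1 :=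
  h.2.2.1 t 1 (by simp)

lemma ioc_zero {Φ Φ' : ℝ → ℝ → ℝ} (h : IsC1FlowOn (Ioc (0:ℝ) 1) Φ Φ') (t : ℝ) : Φ t 0 = 0 :=
  h.2.2.1 t 0 (by simp)

lemma ioc_one {Φ Φ' : ℝ → ℝ → ℝ} (h : IsC1FlowOn (Ioc (0:ℝ) 1) Φ Φ') (t : ℝ) : Φ t 1 = 1 := by
  have h0 : (1:ℝ) ∈ Ioc (0:ℝ) 1 := by simp
  obtain ⟨y, hy, hy0⟩ := (h.2.2.2.1 t).surjOn h0
  have h1 := (h.strictMonoOn (convex_Ioc 0 1) t).monotoneOn hy h0 hy.2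
  exact le_antisymm (h.mem t h0).2 (hy0.symm.le.trans h1)

lemma ico_ioo {Φ Φ' : ℝ → ℝ → ℝ} (h : IsC1FlowOn (Ico (0:ℝ) 1) Φ Φ') (t : ℝ) {x : ℝ}
    (hx : x ∈ Ioo (0:ℝ) 1) : Φ t x ∈ Ioo (0:ℝ) 1 := by
  have h1 := (h.strictMonoOn (convex_Ico 0 1) t) (by simp) (Ioo_subset_Ico_self hx) hx.1
  rw [ico_zero h] at h1
  exact ⟨h1, (h.mem t (Ioo_subset_Ico_self hx)).2⟩

lemma ioc_ioo {Φ Φ' : ℝ → ℝ → ℝ} (h : IsC1FlowOn (Ioc (0:ℝ) 1) Φ Φ') (t : ℝ) {x : ℝ}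
    (hx : x ∈ Ioo (0:ℝ) 1) : Φ t x ∈ Ioo (0:ℝ) 1 := by
  have h1 := (h.strictMonoOn (convex_Ioc 0 1) t) (Ioo_subset_Ioc_self hx) (by simp) hx.2
  rw [ioc_one h] at h1
  exact ⟨(h.mem t (Ioo_subset_Ioc_self hx)).1, h1⟩

lemma ico_mono {Φ Φ' : ℝ → ℝ → ℝ} (h : IsC1FlowOn (Ico (0:ℝ) 1) Φ Φ') (t : ℝ) :
    MonotoneOn (Φ t) (Icc (0:ℝ) 1) := by
  intro x hx y hy hxy
  rcases hy.2.lt_or_eq with h1 | h1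
  · exact (h.strictMonoOn (convex_Ico 0 1) t).monotoneOn ⟨hx.1, hxy.trans_lt h1⟩ ⟨hy.1, h1⟩ hxy
  · rw [h1, ico_one h]
    rcases hx.2.lt_or_eq with h2 | h2
    · exact (h.mem t ⟨hx.1, h2⟩).2.le
    · rw [h2, ico_one h]

lemma ico_icc {Φ Φ' : ℝ → ℝ → ℝ} (h : IsC1FlowOn (Ico (0:ℝ) 1) Φ Φ') (t : ℝ) {x : ℝ}
    (hx : x ∈ Icc (0:ℝ) 1) : Φ t x ∈ Icc (0:ℝ) 1 := by
  have h1 := ico_mono h t (by simp) hx hx.1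
  have h2 := ico_mono h t hx (by simp) hx.2
  rw [ico_zero h] at h1
  rw [ico_one h] at h2
  exact ⟨h1, h2⟩

lemma udIco : UniqueDiffOn ℝ (Ico (0:ℝ) 1) := uniqueDiffOn_Ico 0 1

lemma udIoc : UniqueDiffOn ℝ (Ioc (0:ℝ) 1) := uniqueDiffOn_Ioc 0 1

structure Core (Φ Φ' Ψ Ψ' : ℝ → ℝ → ℝ) (l : ℝ → ℝ) : Prop where
  hΦ : IsC1FlowOn (Ico (0:ℝ) 1) Φ Φ'
  hΨ : IsC1FlowOn (Ioc (0:ℝ) 1) Ψ Ψ'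
  h1 : ∀ x, Ψ 1 x = Φ 1 x
  hlt : ∀ x ∈ Ioo (0:ℝ) 1, Φ 1 x < x
  hc : ContinuousOn l (Icc (0:ℝ) 1)
  hv : BoundedVariationOn l (Icc (0:ℝ) 1)
  hlΦ : ∀ x ∈ Ico (0:ℝ) 1, Real.log (Φ' 1 x) = l x
  hlΨ : ∀ x ∈ Ioc (0:ℝ) 1, Real.log (Ψ' 1 x) = l x

namespace Core

variable {Φ Φ' Ψ Ψ' : ℝ → ℝ → ℝ} {l : ℝ → ℝ}

lemma nat_eq (C : Core Φ Φ' Ψ Ψ' l) (n : ℕ) (x : ℝ) : Ψ n x = Φ n x := by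
  induction n generalizing x with
  | zero => simp [C.hΦ.1, C.hΨ.1]
  | succ n ih =>
    push_cast
    rw [C.hΦ.2.1, C.hΨ.2.1, ih, C.h1]

lemma neg_eq (C : Core Φ Φ' Ψ Ψ' l) (n : ℕ) (x : ℝ) : Ψ (-n) x = Φ (-n) x := by
  have h := C.nat_eq n (Ψ (-n) x)
  rw [C.hΨ.cancel_neg] at h
  rw [h, C.hΦ.neg_cancel, ← h]

lemma iter_eq (C : Core Φ Φ' Ψ Ψ' l) (n : ℕ) (x : ℝ) : (Φ 1)^[n] x = Φ n x := by
  induction n with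
  | zero => simp [C.hΦ.1]
  | succ n ih =>
    rw [Function.iterate_succ_apply', ih, ← C.hΦ.2.1]
    push_cast; rw [add_comm]

lemma dΦ (C : Core Φ Φ' Ψ Ψ' l) {x : ℝ} (hx : x ∈ Ioo (0:ℝ) 1) :
    ∃ X < 0, ∀ t, HasDerivAt (fun t => Φ t x) (Φ' t x * X) t := by
  obtain ⟨a, ha, h⟩ := C.hΦ.time_deriv (Ico_mem_nhds hx.1 hx.2)
  exact ⟨_, div_neg_of_neg_of_pos (sub_neg.2 (C.hlt x hx)) ha, h⟩

lemma dΨ (C : Core Φ Φ' Ψ Ψ' l) {x : ℝ} (hx : x ∈ Ioo (0:ℝ) 1) :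
    ∃ X < 0, ∀ t, HasDerivAt (fun t => Ψ t x) (Ψ' t x * X) t := by
  obtain ⟨a, ha, h⟩ := C.hΨ.time_deriv (Ioc_mem_nhds hx.1 hx.2)
  rw [C.h1] at h
  exact ⟨_, div_neg_of_neg_of_pos (sub_neg.2 (C.hlt x hx)) ha, h⟩

lemma antiΦ (C : Core Φ Φ' Ψ Ψ' l) {x : ℝ} (hx : x ∈ Ioo (0:ℝ) 1) :
    StrictAnti (fun t => Φ t x) := by
  obtain ⟨X, hX, h⟩ := C.dΦ hx
  refine strictAnti_of_deriv_neg fun t => ?_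
  rw [(h t).deriv]
  exact mul_neg_of_pos_of_neg (C.hΦ.2.2.2.2.2.2.1 t x (Ioo_subset_Ico_self hx)) hX

lemma antiΨ (C : Core Φ Φ' Ψ Ψ' l) {x : ℝ} (hx : x ∈ Ioo (0:ℝ) 1) :
    StrictAnti (fun t => Ψ t x) := by
  obtain ⟨X, hX, h⟩ := C.dΨ hx
  refine strictAnti_of_deriv_neg fun t => ?_
  rw [(h t).deriv]
  exact mul_neg_of_pos_of_neg (C.hΨ.2.2.2.2.2.2.1 t x (Ioo_subset_Ioc_self hx)) hX

lemma tend0 (C : Core Φ Φ' Ψ Ψ' l) {x : ℝ} (hx : x ∈ Ioo (0:ℝ) 1) :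
    Tendsto (fun n : ℕ => Φ n x) atTop (𝓝 0) := by
  have hanti : Antitone (fun n : ℕ => Φ n x) := fun m n hmn =>
    (C.antiΦ hx).antitone (Nat.cast_le.2 hmn)
  have hbdd : BddBelow (range fun n : ℕ => Φ n x) :=
    ⟨0, by rintro _ ⟨n, rfl⟩; exact (ico_ioo C.hΦ n hx).1.le⟩
  have ht := tendsto_atTop_ciInf hanti hbdd
  set z := ⨅ n : ℕ, Φ n x with hz
  have hz0 : 0 ≤ z := le_ciInf fun n => (ico_ioo C.hΦ n hx).1.le
  have hz1 : z < 1 := (ciInf_le hbdd 0).trans_lt (ico_ioo C.hΦ _ hx).2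
  rcases hz0.eq_or_lt with h | h
  · rw [h]; exact ht
  · exfalso
    have hc : ContinuousWithinAt (Φ 1) (Ico (0:ℝ) 1) z :=
      (C.hΦ.2.2.2.2.1 1 z ⟨hz0, hz1⟩).continuousWithinAt
    have h2 : Tendsto (fun n : ℕ => Φ 1 (Φ n x)) atTop (𝓝 (Φ 1 z)) :=
      hc.tendsto.comp (tendsto_nhdsWithin_iff.2
        ⟨ht, Eventually.of_forall fun n => Ioo_subset_Ico_self (ico_ioo C.hΦ _ hx)⟩)
    have h3 : Tendsto (fun n : ℕ => Φ 1 (Φ n x)) atTop (𝓝 z) := by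
      have := (tendsto_add_atTop_iff_nat 1).2 ht
      refine this.congr fun n => ?_
      rw [← C.hΦ.2.1]; push_cast; rw [add_comm]
    exact (C.hlt z ⟨h, hz1⟩).ne (tendsto_nhds_unique h2 h3)

lemma tend1 (C : Core Φ Φ' Ψ Ψ' l) {x : ℝ} (hx : x ∈ Ioo (0:ℝ) 1) :
    Tendsto (fun n : ℕ => Ψ (-n) x) atTop (𝓝 1) := by
  have hmono : Monotone (fun n : ℕ => Ψ (-n) x) := fun m n hmn =>
    (C.antiΨ hx).antitone (neg_le_neg (Nat.cast_le.2 hmn))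
  have hbdd : BddAbove (range fun n : ℕ => Ψ (-n) x) :=
    ⟨1, by rintro _ ⟨n, rfl⟩; exact (ioc_ioo C.hΨ _ hx).2.le⟩
  have ht := tendsto_atTop_ciSup hmono hbdd
  set z := ⨆ n : ℕ, Ψ (-n) x with hz
  have hz1 : z ≤ 1 := ciSup_le fun n => (ioc_ioo C.hΨ _ hx).2.le
  have hz0 : 0 < z := (ioc_ioo C.hΨ _ hx).1.trans_le (le_ciSup hbdd 0)
  rcases hz1.eq_or_lt with h | h
  · rw [← h]; exact ht
  · exfalso
    have hc : ContinuousWithinAt (Ψ 1) (Ioc (0:ℝ) 1) z :=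
      (C.hΨ.2.2.2.2.1 1 z ⟨hz0, hz1⟩).continuousWithinAt
    have h2 : Tendsto (fun n : ℕ => Ψ 1 (Ψ (-(n + 1 : ℕ)) x)) atTop (𝓝 (Ψ 1 z)) :=
      hc.tendsto.comp (tendsto_nhdsWithin_iff.2
        ⟨(tendsto_add_atTop_iff_nat (f := fun n : ℕ => Ψ (-n) x) 1).2 ht,
          Eventually.of_forall fun n => Ioo_subset_Ioc_self (ioc_ioo C.hΨ _ hx)⟩)
    have h3 : Tendsto (fun n : ℕ => Ψ 1 (Ψ (-(n + 1 : ℕ)) x)) atTop (𝓝 z) := by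
      refine ht.congr fun n => ?_
      rw [← C.hΨ.2.1]; push_cast; congr 1; ring
    rw [C.h1] at h2
    exact (C.hlt z ⟨hz0, h⟩).ne (tendsto_nhds_unique h2 h3)

lemma sumΦ (C : Core Φ Φ' Ψ Ψ' l) (n : ℕ) {x : ℝ} (hx : x ∈ Ico (0:ℝ) 1) :
    Real.log (Φ' n x) = ∑ k ∈ Finset.range n, l (Φ k x) := by
  induction n with
  | zero => simp [C.hΦ.log_zero udIco hx]
  | succ n ih =>
    rw [Finset.sum_range_succ, ← ih]
    push_cast
    rw [add_comm (n:ℝ) 1, C.hΦ.logchain udIco _ _ hx, C.hlΦ _ (C.hΦ.mem _ hx), add_comm]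

lemma sumΨ (C : Core Φ Φ' Ψ Ψ' l) (n : ℕ) {x : ℝ} (hx : x ∈ Ioc (0:ℝ) 1) :
    Real.log (Ψ' (-n) x) = - ∑ k ∈ Finset.range n, l (Ψ (-(k + 1 : ℕ)) x) := by
  induction n with
  | zero => simp [C.hΨ.log_zero udIoc hx]
  | succ n ih =>
    have h := C.hΨ.logchain udIoc 1 (-(n + 1 : ℕ)) hx
    rw [show (1:ℝ) + -((n + 1 : ℕ) : ℝ) = -n by push_cast; ring, ih,
      C.hlΨ _ (C.hΨ.mem _ hx)] at h
    rw [Finset.sum_range_succ]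
    linarith

lemma deriv_eq (C : Core Φ Φ' Ψ Ψ' l) (n : ℕ) {x : ℝ} (hx : x ∈ Ioo (0:ℝ) 1) :
    Ψ' n x = Φ' n x := by
  have h1 := (C.hΦ.2.2.2.2.1 n x (Ioo_subset_Ico_self hx)).hasDerivAt (Ico_mem_nhds hx.1 hx.2)
  have h2 := (C.hΨ.2.2.2.2.1 n x (Ioo_subset_Ioc_self hx)).hasDerivAt (Ioc_mem_nhds hx.1 hx.2)
  have h3 : Ψ n = Φ n := funext fun x => C.nat_eq n x
  rw [h3] at h2
  exact h2.unique h1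

/-- Variation estimate for `Φ` near `0`. -/
lemma end0 (C : Core Φ Φ' Ψ Ψ' l) {y : ℝ} (hy : y ∈ Ioo (0:ℝ) 1) :
    eVariationOn (fun t => Real.log (Φ' t y)) (Icc (0:ℝ) 1)
      ≤ ENNReal.ofReal |l 0| + eVariationOn l (Icc 0 y) := by
  rw [← C.hlΦ 0 (by simp)]
  refine C.hΦ.endpoint udIco (by simp) (ico_zero C.hΦ) (Ioo_subset_Ico_self hy) (fun n : ℕ => n)
    (C.tend0 hy) fun n => ?_
  have e : (fun t => Real.log (Φ' n (Φ t y)))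
      = fun t => ∑ k ∈ Finset.range n, (fun k t => l (Φ (k:ℕ) (Φ t y))) k t := by
    ext t
    exact C.sumΦ n (C.hΦ.mem t (Ioo_subset_Ico_self hy))
  rw [e]
  refine (eVar_sum_le _ _ _).trans ?_
  have hanti : Antitone (fun n : ℕ => Φ n y) := fun m n hmn =>
    (C.antiΦ hy).antitone (Nat.cast_le.2 hmn)
  have h2 : ∀ k ∈ Finset.range n, eVariationOn (fun t => l (Φ (k:ℕ) (Φ t y))) (Icc 0 1)
      ≤ eVariationOn l (Icc (Φ (k + 1 : ℕ) y) (Φ k y)) := by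
    intro k _
    have hA : Antitone fun t => Φ (k:ℕ) (Φ t y) := by
      intro t u htu
      change Φ k (Φ u y) ≤ Φ k (Φ t y)
      rw [← C.hΦ.2.1, ← C.hΦ.2.1]
      exact (C.antiΦ hy).antitone (by linarith)
    refine eVariationOn.comp_le_of_antitoneOn l (fun t => Φ (k:ℕ) (Φ t y)) (hA.antitoneOn _) ?_
    intro t ht
    constructor
    · have := hA ht.2
      simp only [← C.hΦ.2.1] at this ⊢
      push_cast
      exact this
    · have := hA ht.1
      simpa [C.hΦ.1] using this
  refine (Finset.sum_le_sum h2).trans ((eVar_anti_sum_le l hanti n).trans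
    (eVariationOn.mono _ ?_))
  refine Icc_subset_Icc (ico_ioo C.hΦ _ hy).1.le ?_
  simp [C.hΦ.1]

/-- Variation estimate for `Ψ` near `1`. -/
lemma end1 (C : Core Φ Φ' Ψ Ψ' l) {y : ℝ} (hy : y ∈ Ioo (0:ℝ) 1) :
    eVariationOn (fun t => Real.log (Ψ' t y)) (Icc (0:ℝ) 1)
      ≤ ENNReal.ofReal |l 1| + eVariationOn l (Icc y 1) := by
  rw [← C.hlΨ 1 (by simp)]
  refine C.hΨ.endpoint udIoc (by simp) (ioc_one C.hΨ) (Ioo_subset_Ioc_self hy)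
    (fun n : ℕ => -n) (C.tend1 hy) fun n => ?_
  have e : (fun t => Real.log (Ψ' (-n) (Ψ t y)))
      = fun t => - ∑ k ∈ Finset.range n, (fun k t => l (Ψ (-(k + 1 : ℕ)) (Ψ t y))) k t := by
    ext t
    exact C.sumΨ n (C.hΨ.mem t (Ioo_subset_Ioc_self hy))
  rw [e]
  refine (eVar_le (g := fun t => ∑ k ∈ Finset.range n,
    (fun k t => l (Ψ (-(k + 1 : ℕ)) (Ψ t y))) k t) ?_).trans ((eVar_sum_le _ _ _).trans ?_)
  · intro a _ b _
    rw [neg_sub_neg, abs_sub_comm]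
  have hmono : Monotone (fun n : ℕ => Ψ (-n) y) := fun m n hmn =>
    (C.antiΨ hy).antitone (neg_le_neg (Nat.cast_le.2 hmn))
  have h2 : ∀ k ∈ Finset.range n, eVariationOn (fun t => l (Ψ (-(k + 1 : ℕ)) (Ψ t y))) (Icc 0 1)
      ≤ eVariationOn l (Icc (Ψ (-k) y) (Ψ (-(k + 1 : ℕ)) y)) := by
    intro k _
    have hA : Antitone fun t => Ψ (-(k + 1 : ℕ)) (Ψ t y) := by
      intro t u htu
      change Ψ (-(k + 1 : ℕ)) (Ψ u y) ≤ Ψ (-(k + 1 : ℕ)) (Ψ t y)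
      rw [← C.hΨ.2.1, ← C.hΨ.2.1]
      exact (C.antiΨ hy).antitone (by linarith)
    refine eVariationOn.comp_le_of_antitoneOn l (fun t => Ψ (-(k + 1 : ℕ)) (Ψ t y))
      (hA.antitoneOn _) ?_
    intro t ht
    constructor
    · have := hA ht.2
      simp only [← C.hΨ.2.1] at this ⊢
      refine le_trans (le_of_eq ?_) this
      congr 1; push_cast; ring
    · have := hA ht.1
      simp only [C.hΨ.1] at this
      exact this
  refine (Finset.sum_le_sum h2).trans ((eVariationOn.sum' l hmono).le.trans
    (eVariationOn.mono _ ?_))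
  refine Icc_subset_Icc ?_ (ioc_ioo C.hΨ _ hy).2.le
  simp [C.hΨ.1]

end Core

namespace Core

variable {Φ Φ' Ψ Ψ' : ℝ → ℝ → ℝ} {l M : ℝ → ℝ}

lemma half_mem : (1:ℝ) / 2 ∈ Ioo (0:ℝ) 1 := by constructor <;> norm_num

lemma M_strictMono (C : Core Φ Φ' Ψ Ψ' l)
    (hM : ∀ t : ℝ, Ψ (M t) ((1:ℝ)/2) = Φ t ((1:ℝ)/2)) : StrictMono M := by
  intro t u htu
  have h : Φ u (1/2) < Φ t (1/2) := C.antiΦ half_mem htu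
  rw [← hM, ← hM] at h
  exact (C.antiΨ half_mem).lt_iff_gt.1 h

lemma M_zero (C : Core Φ Φ' Ψ Ψ' l)
    (hM : ∀ t : ℝ, Ψ (M t) ((1:ℝ)/2) = Φ t ((1:ℝ)/2)) : M 0 = 0 := by
  apply (C.antiΨ half_mem).injective
  change Ψ (M 0) (1/2) = Ψ 0 (1/2)
  rw [hM, C.hΦ.1, C.hΨ.1]

lemma M_add_one (C : Core Φ Φ' Ψ Ψ' l)
    (hM : ∀ t : ℝ, Ψ (M t) ((1:ℝ)/2) = Φ t ((1:ℝ)/2)) (t : ℝ) : M (t + 1) = M t + 1 := by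
  apply (C.antiΨ half_mem).injective
  change Ψ (M (t + 1)) (1/2) = Ψ (M t + 1) (1/2)
  rw [hM, add_comm t 1, add_comm (M t) 1, C.hΦ.2.1, C.hΨ.2.1, hM, C.h1]

lemma M_continuous (C : Core Φ Φ' Ψ Ψ' l)
    (hM : ∀ t : ℝ, Ψ (M t) ((1:ℝ)/2) = Φ t ((1:ℝ)/2)) : Continuous M := by
  have hanti := C.antiΨ half_mem
  have hcont := C.hΦ.continuous_time (Ioo_subset_Ico_self half_mem)
  rw [continuous_iff_continuousAt]
  intro t₀
  rw [ContinuousAt, tendsto_order]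
  constructor
  · intro a ha
    have h1 : Φ t₀ (1/2) < Ψ a (1/2) := by rw [← hM]; exact hanti ha
    filter_upwards [hcont.continuousAt.eventually_lt_const h1] with t ht
    rw [← hM] at ht
    exact hanti.lt_iff_gt.1 ht
  · intro a ha
    have h1 : Ψ a (1/2) < Φ t₀ (1/2) := by rw [← hM]; exact hanti ha
    filter_upwards [hcont.continuousAt.eventually_const_lt h1] with t ht
    rw [← hM] at ht
    exact hanti.lt_iff_gt.1 ht

lemma M_deriv (C : Core Φ Φ' Ψ Ψ' l)
    (hM : ∀ t : ℝ, Ψ (M t) ((1:ℝ)/2) = Φ t ((1:ℝ)/2)) :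
    ∃ (M' : ℝ → ℝ) (c : ℝ), (∀ t : ℝ, HasDerivAt M (M' t) t) ∧ Continuous M' ∧ (∀ t : ℝ, 0 < M' t) ∧
      ∀ t, Real.log (M' t) = Real.log (Φ' t (1/2)) - Real.log (Ψ' (M t) (1/2)) + c := by
  obtain ⟨X, hX, hdX⟩ := C.dΦ half_mem
  obtain ⟨Y, hY, hdY⟩ := C.dΨ half_mem
  have hi := Ioo_subset_Ico_self half_mem
  have hi' := Ioo_subset_Ioc_self half_mem
  have hpΦ : ∀ t, 0 < Φ' t (1/2) := fun t => C.hΦ.2.2.2.2.2.2.1 t _ hi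
  have hpΨ : ∀ t, 0 < Ψ' t (1/2) := fun t => C.hΨ.2.2.2.2.2.2.1 t _ hi'
  have hXY : 0 < X / Y := div_pos_of_neg_of_neg hX hY
  have e : ∀ t, Φ' t (1/2) * X / (Ψ' (M t) (1/2) * Y)
      = Φ' t (1/2) / Ψ' (M t) (1/2) * (X / Y) := fun t => mul_div_mul_comm _ _ _ _
  have hpos : ∀ t, 0 < Φ' t (1/2) / Ψ' (M t) (1/2) := fun t => div_pos (hpΦ t) (hpΨ _)
  refine ⟨fun t => Φ' t (1/2) * X / (Ψ' (M t) (1/2) * Y), Real.log (X / Y), fun t => ?_, ?_,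
    fun t => ?_, fun t => ?_⟩
  · refine hasDerivAt_of_comp (C.M_continuous hM).continuousAt (hdY (M t))
      (mul_ne_zero (hpΨ _).ne' hY.ne) ?_
    simp only [hM]
    exact hdX t
  · refine Continuous.div ((C.hΦ.continuous_deriv hi).mul continuous_const)
      (((C.hΨ.continuous_deriv hi').comp (C.M_continuous hM)).mul continuous_const) fun t => ?_
    exact mul_ne_zero (hpΨ _).ne' hY.ne
  · simp only [e]
    exact mul_pos (hpos t) hXY
  · simp only [e]
    rw [Real.log_mul (hpos t).ne' hXY.ne', Real.log_div (hpΦ t).ne' (hpΨ _).ne']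

lemma base_change (C : Core Φ Φ' Ψ Ψ' l)
    (hM : ∀ t : ℝ, Ψ (M t) ((1:ℝ)/2) = Φ t ((1:ℝ)/2)) {m : ℝ → ℝ} {c : ℝ}
    (hm : ∀ t, m t = Real.log (Φ' t (1/2)) - Real.log (Ψ' (M t) (1/2)) + c) (k : ℕ) :
    ∃ c', ∀ t, m t = Real.log (Φ' t (Φ (-k) (1/2)))
      - Real.log (Ψ' (M t) (Φ (-k) (1/2))) + c' := by
  set q := Φ (-k) (1/2) with hq
  have hqm : q ∈ Ioo (0:ℝ) 1 := ico_ioo C.hΦ _ half_mem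
  have hp1 : Φ k q = 1/2 := C.hΦ.cancel_neg _ _
  have hp2 : Ψ k q = 1/2 := by rw [C.nat_eq, hp1]
  refine ⟨c - Real.log (Φ' k q) + Real.log (Ψ' k q), fun t => ?_⟩
  have h1 := C.hΦ.cocycle udIco t k (Ioo_subset_Ico_self hqm)
  have h2 := C.hΨ.cocycle udIoc (M t) k (Ioo_subset_Ioc_self hqm)
  have h3 : Ψ (M t) q = Φ t q := by
    rw [hq, ← C.neg_eq, C.hΨ.comm, hM, C.neg_eq, C.neg_eq, C.hΦ.comm]
  rw [h3, C.deriv_eq k (ico_ioo C.hΦ t hqm), hp2] at h2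
  rw [hp1] at h1
  rw [hm]
  linarith

/-- Two-sided comparison on a fundamental domain. -/
lemma fund (C : Core Φ Φ' Ψ Ψ' l)
    (hM : ∀ t : ℝ, Ψ (M t) ((1:ℝ)/2) = Φ t ((1:ℝ)/2)) {m : ℝ → ℝ} {c : ℝ}
    (hm : ∀ t, m t = Real.log (Φ' t (1/2)) - Real.log (Ψ' (M t) (1/2)) + c) (n k : ℕ) :
    eVariationOn (fun x => ∑ j ∈ Finset.range n, l (Φ j x))
        (Icc (Φ 1 (Φ (-k) (1/2))) (Φ (-k) (1/2)))
      ≤ eVariationOn m (Icc 0 1)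
        + ((ENNReal.ofReal |l 0| + eVariationOn l (Icc 0 (Φ n (Φ (-k) (1/2)))))
          + (ENNReal.ofReal |l 1| + eVariationOn l (Icc (Φ (-k) (1/2)) 1))) ∧
    eVariationOn m (Icc 0 1)
      ≤ eVariationOn (fun x => ∑ j ∈ Finset.range n, l (Φ j x))
        (Icc (Φ 1 (Φ (-k) (1/2))) (Φ (-k) (1/2)))
        + ((ENNReal.ofReal |l 0| + eVariationOn l (Icc 0 (Φ n (Φ (-k) (1/2)))))
          + (ENNReal.ofReal |l 1| + eVariationOn l (Icc (Φ (-k) (1/2)) 1))) := by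
  obtain ⟨c', hc'⟩ := C.base_change hM hm k
  set q := Φ (-k) (1/2) with hq
  have hqm : q ∈ Ioo (0:ℝ) 1 := ico_ioo C.hΦ _ half_mem
  have hE0 := C.end0 (ico_ioo C.hΦ n hqm)
  have hE1 : eVariationOn (fun t => Real.log (Ψ' (M t) q)) (Icc (0:ℝ) 1)
      ≤ ENNReal.ofReal |l 1| + eVariationOn l (Icc q 1) := by
    refine le_trans ?_ (C.end1 hqm)
    refine eVariationOn.comp_le_of_monotoneOn (fun s => Real.log (Ψ' s q)) M
      ((C.M_strictMono hM).monotone.monotoneOn _) fun t ht => ?_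
    have h0 := (C.M_strictMono hM).monotone ht.1
    have h1 := (C.M_strictMono hM).monotone ht.2
    have h2 := C.M_add_one hM 0
    rw [C.M_zero hM, zero_add] at h2
    rw [C.M_zero hM] at h0
    rw [h2] at h1
    exact ⟨h0, h1⟩
  have himg : (fun t => Φ t q) '' Icc 0 1 = Icc (Φ 1 q) q := by
    have hanti := C.antiΦ hqm
    apply Subset.antisymm
    · rintro _ ⟨t, ht, rfl⟩
      refine ⟨hanti.antitone ht.2, ?_⟩
      have := hanti.antitone ht.1
      simpa [C.hΦ.1] using this
    · have := intermediate_value_Icc' (zero_le_one' ℝ)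
        (C.hΦ.continuous_time (Ioo_subset_Ico_self hqm)).continuousOn
      rwa [C.hΦ.1] at this
  have hvar : eVariationOn (fun x => ∑ j ∈ Finset.range n, l (Φ j x)) (Icc (Φ 1 q) q)
      = eVariationOn (fun t => Real.log (Φ' n (Φ t q))) (Icc 0 1) := by
    rw [← himg, ← eVariationOn.comp_eq_of_antitoneOn _ _ ((C.antiΦ hqm).antitone.antitoneOn _)]
    refine eVariationOn.eq_of_eqOn fun t _ => ?_
    exact (C.sumΦ n (C.hΦ.mem t (Ioo_subset_Ico_self hqm))).symm
  rw [hvar]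
  have hcc : ∀ t, Real.log (Φ' n (Φ t q))
      = Real.log (Φ' t (Φ n q)) + Real.log (Φ' n q) - Real.log (Φ' t q) := fun t => by
    have := C.hΦ.cocycle udIco t n (Ioo_subset_Ico_self hqm)
    linarith
  set A := fun t => Real.log (Φ' t (Φ n q)) with hA
  set B := fun t => Real.log (Ψ' (M t) q) with hB
  set G := fun t => Real.log (Φ' n (Φ t q)) with hG
  have rel : ∀ t, G t = A t - B t - m t + (Real.log (Φ' n q) + c') := fun t => by
    simp only [hG, hA, hB, hcc, hc']; ring
  have hAB : eVariationOn (fun t => A t - B t) (Icc 0 1) ≤ (ENNReal.ofReal |l 0|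
      + eVariationOn l (Icc 0 (Φ n q))) + (ENNReal.ofReal |l 1| + eVariationOn l (Icc q 1)) := by
    refine (eVar_le_add (g := A) (h := B) fun x _ y _ => ?_).trans (add_le_add hE0 hE1)
    rw [show A x - B x - (A y - B y) = (A x - A y) - (B x - B y) by ring]
    exact abs_sub _ _
  constructor
  · refine (eVar_le_add (g := m) (h := fun t => A t - B t) fun x _ y _ => ?_).trans
      (by gcongr)
    rw [rel, rel, add_sub_add_right_eq_sub, add_comm |m x - m y|,
      show A x - B x - m x - (A y - B y - m y) = (A x - B x - (A y - B y)) - (m x - m y) by ring]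
    exact abs_sub _ _
  · refine (eVar_le_add (g := G) (h := fun t => A t - B t) fun x _ y _ => ?_).trans
      (by gcongr)
    rw [show m x - m y = (A x - B x - (A y - B y)) - (G x - G y) by rw [rel, rel]; ring, add_comm]
    exact abs_sub _ _

lemma var_ne_top (C : Core Φ Φ' Ψ Ψ' l) {s : Set ℝ} (hs : s ⊆ Icc 0 1) :
    eVariationOn l s ≠ ⊤ := C.hv.mono hs

lemma tail0 (C : Core Φ Φ' Ψ Ψ' l) :
    Tendsto (fun j : ℕ => eVariationOn l (Icc 0 (Φ j (1/2)))) atTop (𝓝 0) := by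
  have h0 : (0:ℝ) ∈ Icc (0:ℝ) 1 := by simp
  have h := C.hv.tendsto_eVariationOn_Icc_right (x := 0) (l := l 0)
    ((C.hc 0 h0).tendsto.mono_left (nhdsWithin_mono _ inter_subset_left)) h0
  rw [edist_self] at h
  have h2 : Tendsto (fun j : ℕ => Φ j (1/2)) atTop (𝓝[Icc 0 1 ∩ Ioi 0] 0) :=
    tendsto_nhdsWithin_iff.2 ⟨C.tend0 half_mem, Eventually.of_forall fun n =>
      ⟨Ioo_subset_Icc_self (ico_ioo C.hΦ _ half_mem), (ico_ioo C.hΦ _ half_mem).1⟩⟩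
  refine (h.comp h2).congr fun j => ?_
  simp only [Function.comp]
  congr 1
  exact inter_eq_right.2 (Icc_subset_Icc le_rfl (ico_ioo C.hΦ _ half_mem).2.le)

lemma tail1 (C : Core Φ Φ' Ψ Ψ' l) :
    Tendsto (fun j : ℕ => eVariationOn l (Icc (Φ (-j) (1/2)) 1)) atTop (𝓝 0) := by
  have h0 : (1:ℝ) ∈ Icc (0:ℝ) 1 := by simp
  have h := C.hv.tendsto_eVariationOn_Icc_left (x := 1) (l := l 1)
    ((C.hc 1 h0).tendsto.mono_left (nhdsWithin_mono _ inter_subset_left)) h0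
  rw [edist_self] at h
  have h2 : Tendsto (fun j : ℕ => Φ (-j) (1/2)) atTop (𝓝[Icc 0 1 ∩ Iio 1] 1) :=
    tendsto_nhdsWithin_iff.2 ⟨by simpa only [C.neg_eq] using C.tend1 half_mem,
      Eventually.of_forall fun n =>
      ⟨Ioo_subset_Icc_self (ico_ioo C.hΦ _ half_mem), (ico_ioo C.hΦ _ half_mem).2⟩⟩
  refine (h.comp h2).congr fun j => ?_
  simp only [Function.comp]
  congr 1
  exact inter_eq_right.2 (Icc_subset_Icc (ico_ioo C.hΦ _ half_mem).1.le le_rfl)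

/-- Comparison of the total variation of `log D(fⁿ)` with `n` times that of `log DM`. -/
lemma total (C : Core Φ Φ' Ψ Ψ' l)
    (hM : ∀ t : ℝ, Ψ (M t) ((1:ℝ)/2) = Φ t ((1:ℝ)/2)) {m : ℝ → ℝ} {c : ℝ}
    (hm : ∀ t, m t = Real.log (Φ' t (1/2)) - Real.log (Ψ' (M t) (1/2)) + c) (n : ℕ) :
    eVariationOn (fun x => ∑ j ∈ Finset.range n, l (Φ j x)) (Icc 0 1)
      ≤ n * (eVariationOn m (Icc 0 1) + (ENNReal.ofReal |l 0| + ENNReal.ofReal |l 1|))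
        + 2 * ∑ j ∈ Finset.range n, (eVariationOn l (Icc 0 (Φ j (1/2)))
          + eVariationOn l (Icc (Φ (-j) (1/2)) 1)) ∧
    n * eVariationOn m (Icc 0 1)
      ≤ eVariationOn (fun x => ∑ j ∈ Finset.range n, l (Φ j x)) (Icc 0 1)
        + n * (ENNReal.ofReal |l 0| + ENNReal.ofReal |l 1|)
        + 2 * ∑ j ∈ Finset.range n, (eVariationOn l (Icc 0 (Φ j (1/2)))
          + eVariationOn l (Icc (Φ (-j) (1/2)) 1)) := by
  set L := fun x => ∑ j ∈ Finset.range n, l (Φ j x) with hL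
  set v0 : ℕ → ENNReal := fun j => eVariationOn l (Icc 0 (Φ j (1/2))) with hv0
  set v1 : ℕ → ENNReal := fun j => eVariationOn l (Icc (Φ (-j) (1/2)) 1) with hv1
  set P : ℕ → ℝ := fun j => Φ (-j) (1/2) with hP
  have hPm : ∀ j, P j ∈ Ioo (0:ℝ) 1 := fun j => ico_ioo C.hΦ _ half_mem
  have hPmono : Monotone P := fun i j hij =>
    (C.antiΦ half_mem).antitone (neg_le_neg (Nat.cast_le.2 hij))
  have hP0 : P 0 = 1/2 := by simp [hP, C.hΦ.1]
  -- decomposition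
  have hdec : eVariationOn L (Icc 0 1) = eVariationOn L (Icc 0 (P 0))
      + ∑ i ∈ Finset.range n, eVariationOn L (Icc (P i) (P (i + 1)))
      + eVariationOn L (Icc (P n) 1) := by
    rw [eVariationOn.sum' L hPmono]
    have e1 := eVariationOn.Icc_add_Icc L (s := univ) (hPm 0).1.le (hPmono (Nat.zero_le n))
      (mem_univ _)
    have e2 := eVariationOn.Icc_add_Icc L (s := univ) (hPm n).1.le (hPm n).2.le
      (mem_univ _)
    simp only [univ_inter] at e1 e2
    rw [e1, e2]
  -- tails
  have ht0 : eVariationOn L (Icc 0 (P 0)) ≤ ∑ j ∈ Finset.range n, v0 j := by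
    refine (eVar_sum_le (fun j x => l (Φ (j:ℕ) x)) _ n).trans (Finset.sum_le_sum fun j _ => ?_)
    have hsub : Icc 0 (P 0) ⊆ Icc (0:ℝ) 1 := Icc_subset_Icc le_rfl (hPm 0).2.le
    refine eVariationOn.comp_le_of_monotoneOn l (Φ j) ((ico_mono C.hΦ j).mono hsub) ?_
    intro x hx
    refine ⟨(ico_icc C.hΦ j (hsub hx)).1, ?_⟩
    rw [← hP0]
    exact ico_mono C.hΦ j (hsub hx) (Ioo_subset_Icc_self (hPm 0)) hx.2
  have hv1anti : Antitone v1 := fun i j hij =>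
    eVariationOn.mono _ (Icc_subset_Icc (hPmono hij) le_rfl)
  have ht1 : eVariationOn L (Icc (P n) 1) ≤ ∑ j ∈ Finset.range n, v1 j := by
    rw [← Finset.sum_range_reflect]
    refine (eVar_sum_le (fun j x => l (Φ (j:ℕ) x)) _ n).trans (Finset.sum_le_sum fun j hj => ?_)
    have hsub : Icc (P n) 1 ⊆ Icc (0:ℝ) 1 := Icc_subset_Icc (hPm n).1.le le_rfl
    refine (eVariationOn.comp_le_of_monotoneOn l (Φ j) (s := Icc (P (n - j)) 1)
      ((ico_mono C.hΦ j).mono hsub) ?_).trans (hv1anti (by omega))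
    intro x hx
    refine ⟨?_, (ico_icc C.hΦ j (hsub hx)).2⟩
    have h1 := ico_mono C.hΦ j (Ioo_subset_Icc_self (hPm n)) (hsub hx) hx.1
    refine le_trans (le_of_eq ?_) h1
    simp only [hP]
    rw [← C.hΦ.2.1, Nat.cast_sub (Finset.mem_range.1 hj).le]
    congr 1; ring
  -- the middle part
  have hmid : ∀ i ∈ Finset.range n,
      eVariationOn L (Icc (P i) (P (i + 1))) ≤ eVariationOn m (Icc 0 1)
        + (ENNReal.ofReal |l 0| + ENNReal.ofReal |l 1|) + (v0 (n - 1 - i) + v1 i) ∧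
      eVariationOn m (Icc 0 1) ≤ eVariationOn L (Icc (P i) (P (i + 1)))
        + (ENNReal.ofReal |l 0| + ENNReal.ofReal |l 1|) + (v0 (n - 1 - i) + v1 i) := by
    intro i hi
    have hi' := Finset.mem_range.1 hi
    obtain ⟨f1, f2⟩ := C.fund hM hm n (i + 1)
    have e1 : Φ 1 (Φ (-((i + 1 : ℕ) : ℝ)) (1/2)) = P i := by
      rw [← C.hΦ.2.1]; simp only [hP]; congr 1; push_cast; ring
    have e2 : Φ n (Φ (-((i + 1 : ℕ) : ℝ)) (1/2)) = Φ ((n - 1 - i : ℕ) : ℝ) (1/2) := by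
      rw [← C.hΦ.2.1]; congr 1
      rw [Nat.sub_sub, Nat.cast_sub (by omega)]; push_cast; ring
    rw [e1, e2] at f1 f2
    have hle : v1 (i + 1) ≤ v1 i := hv1anti (Nat.le_succ i)
    have hE : (ENNReal.ofReal |l 0| + v0 (n - 1 - i)) + (ENNReal.ofReal |l 1| + v1 (i + 1))
        ≤ (ENNReal.ofReal |l 0| + ENNReal.ofReal |l 1|) + (v0 (n - 1 - i) + v1 i) := by
      calc _ ≤ (ENNReal.ofReal |l 0| + v0 (n - 1 - i)) + (ENNReal.ofReal |l 1| + v1 i) := by gcongr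
        _ = _ := by ring
    constructor
    · exact (f1.trans (add_le_add_right hE _)).trans (le_of_eq (add_assoc _ _ _).symm)
    · exact (f2.trans (add_le_add_right hE _)).trans (le_of_eq (add_assoc _ _ _).symm)
  have hrefl : ∑ i ∈ Finset.range n, (v0 (n - 1 - i) + v1 i)
      = ∑ j ∈ Finset.range n, (v0 j + v1 j) := by
    rw [Finset.sum_add_distrib, Finset.sum_add_distrib, Finset.sum_range_reflect]
  constructor
  · rw [hdec]
    have h3 := Finset.sum_le_sum fun i hi => (hmid i hi).1
    rw [Finset.sum_add_distrib, hrefl, Finset.sum_const, Finset.card_range, nsmul_eq_mul] at h3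
    refine (add_le_add (add_le_add ht0 h3) ht1).trans (le_of_eq ?_)
    rw [Finset.sum_add_distrib]
    ring
  · have h3 := Finset.sum_le_sum fun i hi => (hmid i hi).2
    rw [Finset.sum_add_distrib, hrefl, Finset.sum_add_distrib, Finset.sum_const, Finset.sum_const,
      Finset.card_range, nsmul_eq_mul, nsmul_eq_mul] at h3
    refine h3.trans ?_
    have h4 : ∑ i ∈ Finset.range n, eVariationOn L (Icc (P i) (P (i + 1)))
        ≤ eVariationOn L (Icc 0 1) := by
      rw [hdec, add_assoc, add_left_comm]
      exact le_self_add
    have h5 : ∑ j ∈ Finset.range n, (v0 j + v1 j) ≤ 2 * ∑ j ∈ Finset.range n, (v0 j + v1 j) := by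
      rw [two_mul]; exact le_self_add
    gcongr

lemma m_bv (C : Core Φ Φ' Ψ Ψ' l)
    (hM : ∀ t : ℝ, Ψ (M t) ((1:ℝ)/2) = Φ t ((1:ℝ)/2)) {m : ℝ → ℝ} {c : ℝ}
    (hm : ∀ t, m t = Real.log (Φ' t (1/2)) - Real.log (Ψ' (M t) (1/2)) + c) :
    eVariationOn m (Icc 0 1) ≠ ⊤ := by
  have hq : Φ (-((0:ℕ):ℝ)) (1/2) ∈ Ioo (0:ℝ) 1 := ico_ioo C.hΦ _ half_mem
  have hq' : Φ ((0:ℕ):ℝ) (Φ (-((0:ℕ):ℝ)) (1/2)) ∈ Ioo (0:ℝ) 1 := ico_ioo C.hΦ _ hq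
  refine ne_top_of_le_ne_top ?_ (C.fund hM hm 0 0).2
  simp only [ENNReal.add_ne_top, ENNReal.ofReal_ne_top, ne_eq, not_false_eq_true, true_and]
  refine ⟨?_, C.var_ne_top (Icc_subset_Icc le_rfl hq'.2.le),
    C.var_ne_top (Icc_subset_Icc hq.1.le le_rfl)⟩
  simp only [Finset.range_zero, Finset.sum_empty]
  rw [eVariationOn.constant_on]
  · simp
  · rintro a ⟨x, _, rfl⟩ b ⟨y, _, rfl⟩; rfl

theorem main (C : Core Φ Φ' Ψ Ψ' l)
    (hM : ∀ t : ℝ, Ψ (M t) ((1:ℝ)/2) = Φ t ((1:ℝ)/2)) :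
    ∃ M' : ℝ → ℝ,
      (∀ t : ℝ, HasDerivAt M (M' t) t) ∧ Continuous M' ∧ (∀ t : ℝ, 0 < M' t) ∧
      (∀ t, M' (t + 1) = M' t) ∧
      BoundedVariationOn (fun t => Real.log (M' t)) (Icc (0:ℝ) 1) ∧
      ∀ V : ℝ, Tendsto (fun n : ℕ => (eVariationOn (fun x => ∑ j ∈ Finset.range n, l (Φ j x))
          (Icc 0 1)).toReal / n) atTop (𝓝 V) →
        |(eVariationOn (fun t => Real.log (M' t)) (Icc (0:ℝ) 1)).toReal - V| ≤
          |l 0| + |l 1| := by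
  obtain ⟨M', c, hd, hcont, hpos, hm⟩ := C.M_deriv hM
  have hbv := C.m_bv hM (m := fun t => Real.log (M' t)) hm
  refine ⟨M', hd, hcont, hpos, fun t => ?_, hbv, fun V hV => ?_⟩
  · have h1 : HasDerivAt (fun t => M (t + 1)) (M' (t + 1)) t := (hd (t + 1)).comp_add_const t 1
    have h2 : HasDerivAt (fun t => M (t + 1)) (M' t) t := by
      simp only [C.M_add_one hM]
      exact (hd t).add_const 1
    exact h1.unique h2
  · have htot := C.total hM (m := fun t => Real.log (M' t)) hm
    set W := eVariationOn (fun t => Real.log (M' t)) (Icc 0 1) with hW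
    set v : ℕ → ENNReal := fun j => eVariationOn l (Icc 0 (Φ j (1/2)))
      + eVariationOn l (Icc (Φ (-j) (1/2)) 1) with hv
    have hvtop : ∀ j, v j ≠ ⊤ := fun j => ENNReal.add_ne_top.2
      ⟨C.var_ne_top (Icc_subset_Icc le_rfl (ico_ioo C.hΦ _ half_mem).2.le),
        C.var_ne_top (Icc_subset_Icc (ico_ioo C.hΦ _ half_mem).1.le le_rfl)⟩
    have hvt : Tendsto v atTop (𝓝 0) := by
      have := C.tail0.add C.tail1
      rw [add_zero] at this
      exact this
    have hvr : Tendsto (fun j => (v j).toReal) atTop (𝓝 0) := by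
      have := (ENNReal.tendsto_toReal ENNReal.zero_ne_top).comp hvt
      rw [ENNReal.toReal_zero] at this
      exact this
    have hces := hvr.cesaro
    have hces2 : Tendsto (fun n : ℕ => |l 0| + |l 1|
        + 2 * ((n⁻¹ : ℝ) * ∑ i ∈ Finset.range n, (v i).toReal)) atTop
        (𝓝 (|l 0| + |l 1|)) := by
      simpa using (hces.const_mul 2).const_add (|l 0| + |l 1|)
    refine le_of_tendsto_of_tendsto (hV.const_sub W.toReal).abs hces2 ?_
    filter_upwards [eventually_gt_atTop 0] with n hn
    have hn' : (0:ℝ) < n := Nat.cast_pos.2 hn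
    obtain ⟨t1, t2⟩ := htot n
    set U := eVariationOn (fun x => ∑ j ∈ Finset.range n, l (Φ j x)) (Icc 0 1) with hU
    have hS : ∑ j ∈ Finset.range n, v j ≠ ⊤ := ENNReal.sum_ne_top.2 fun j _ => hvtop j
    have hSr : (∑ j ∈ Finset.range n, v j).toReal = ∑ j ∈ Finset.range n, (v j).toReal :=
      ENNReal.toReal_sum fun j _ => hvtop j
    have hA : ENNReal.ofReal |l 0| + ENNReal.ofReal |l 1| ≠ ⊤ := by simp
    have hAr : (ENNReal.ofReal |l 0| + ENNReal.ofReal |l 1|).toReal = |l 0| + |l 1| := by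
      rw [ENNReal.toReal_add (by simp) (by simp), ENNReal.toReal_ofReal (abs_nonneg _),
        ENNReal.toReal_ofReal (abs_nonneg _)]
    set A := ENNReal.ofReal |l 0| + ENNReal.ofReal |l 1| with hAdef
    set S := ∑ j ∈ Finset.range n, v j with hSdef
    have hnt : (n : ENNReal) ≠ ⊤ := ENNReal.natCast_ne_top n
    have hR1 : (n : ENNReal) * (W + A) + 2 * S ≠ ⊤ :=
      ENNReal.add_ne_top.2 ⟨ENNReal.mul_ne_top hnt (ENNReal.add_ne_top.2 ⟨hbv, hA⟩),
        ENNReal.mul_ne_top (by simp) hS⟩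
    have hUt : U ≠ ⊤ := ne_top_of_le_ne_top hR1 t1
    have hR2 : U + n * A + 2 * S ≠ ⊤ :=
      ENNReal.add_ne_top.2 ⟨ENNReal.add_ne_top.2 ⟨hUt, ENNReal.mul_ne_top hnt hA⟩,
        ENNReal.mul_ne_top (by simp) hS⟩
    have r1 := ENNReal.toReal_mono hR1 t1
    have r2 := ENNReal.toReal_mono hR2 t2
    rw [ENNReal.toReal_add (ENNReal.mul_ne_top hnt (ENNReal.add_ne_top.2 ⟨hbv, hA⟩))
      (ENNReal.mul_ne_top (by simp) hS), ENNReal.toReal_mul, ENNReal.toReal_mul,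
      ENNReal.toReal_add hbv hA, hAr, hSr] at r1
    rw [ENNReal.toReal_add (ENNReal.add_ne_top.2 ⟨hUt, ENNReal.mul_ne_top hnt hA⟩)
      (ENNReal.mul_ne_top (by simp) hS), ENNReal.toReal_add hUt (ENNReal.mul_ne_top hnt hA),
      ENNReal.toReal_mul, ENNReal.toReal_mul, ENNReal.toReal_mul, hAr, hSr] at r2
    simp only [ENNReal.toReal_natCast, ENNReal.toReal_ofNat] at r1 r2
    set T := ∑ j ∈ Finset.range n, (v j).toReal with hT
    have e1 : W.toReal - U.toReal / n = (n * W.toReal - U.toReal) / n := by field_simp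
    have e2 : |l 0| + |l 1| + 2 * ((n:ℝ)⁻¹ * T) = (n * (|l 0| + |l 1|) + 2 * T) / n := by
      field_simp
    rw [e1, e2, abs_div, abs_of_pos hn']
    gcongr
    rw [abs_le]
    constructor <;> linarith

end Core


/-! ### Reduction of the statement to the core setting -/

lemma ico_surj {Φ Φ' : ℝ → ℝ → ℝ} (h : IsC1FlowOn (Ico (0:ℝ) 1) Φ Φ') (t : ℝ) :
    Φ t '' Icc (0:ℝ) 1 = Icc (0:ℝ) 1 := by
  apply Subset.antisymm
  · rintro _ ⟨x, hx, rfl⟩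
    exact ico_icc h t hx
  · intro x hx
    exact ⟨Φ (-t) x, ico_icc h _ hx, h.cancel_neg t x⟩

lemma iter_flow {Φ Φ' : ℝ → ℝ → ℝ} (h : IsC1FlowOn (Ico (0:ℝ) 1) Φ Φ') (n : ℕ) (x : ℝ) :
    (Φ 1)^[n] x = Φ n x := by
  induction n with
  | zero => simp [h.1]
  | succ n ih =>
    rw [Function.iterate_succ_apply', ih, ← h.2.1]
    push_cast; rw [add_comm]

lemma logDIter_eq {f : C1bvDiffeo} {Φ Φ' : ℝ → ℝ → ℝ} (h : IsC1FlowOn (Ico (0:ℝ) 1) Φ Φ')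
    (h1 : ∀ x : ℝ, Φ 1 x = f.toFun x) (n : ℕ) :
    logDIter f n = fun x => ∑ k ∈ Finset.range n, Real.log (f.derivFun (Φ k x)) := by
  have h2 : f.toFun = Φ 1 := (funext h1).symm
  ext x
  simp only [logDIter, h2, iter_flow h]

lemma logDIter_add {f : C1bvDiffeo} {Φ Φ' : ℝ → ℝ → ℝ} (h : IsC1FlowOn (Ico (0:ℝ) 1) Φ Φ')
    (h1 : ∀ x : ℝ, Φ 1 x = f.toFun x) (m n : ℕ) (x : ℝ) :
    logDIter f (m + n) x = logDIter f m x + logDIter f n (Φ m x) := by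
  rw [logDIter_eq h h1, logDIter_eq h h1, logDIter_eq h h1]
  simp only
  rw [Finset.sum_range_add]
  congr 1
  refine Finset.sum_congr rfl fun k _ => ?_
  rw [← h.2.1]
  push_cast
  rw [add_comm]

lemma logDIter_bv {f : C1bvDiffeo} {Φ Φ' : ℝ → ℝ → ℝ} (h : IsC1FlowOn (Ico (0:ℝ) 1) Φ Φ')
    (h1 : ∀ x : ℝ, Φ 1 x = f.toFun x) (n : ℕ) :
    eVariationOn (logDIter f n) (Icc 0 1) ≠ ⊤ := by
  rw [logDIter_eq h h1]
  refine ne_top_of_le_ne_top ?_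
    (eVar_sum_le (fun k x => Real.log (f.derivFun (Φ k x))) (Icc 0 1) n)
  refine ENNReal.sum_ne_top.2 fun k _ => ne_top_of_le_ne_top f.logDeriv_bv ?_
  exact eVariationOn.comp_le_of_monotoneOn (fun x => Real.log (f.derivFun x)) (Φ k)
    (ico_mono h k) fun x hx => ico_icc h k hx

lemma var_subadd {f : C1bvDiffeo} {Φ Φ' : ℝ → ℝ → ℝ} (h : IsC1FlowOn (Ico (0:ℝ) 1) Φ Φ')
    (h1 : ∀ x : ℝ, Φ 1 x = f.toFun x) : Subadditive (varLogDIter f) := by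
  intro m n
  have key : eVariationOn (logDIter f (m + n)) (Icc 0 1)
      ≤ eVariationOn (logDIter f m) (Icc 0 1) + eVariationOn (logDIter f n) (Icc 0 1) := by
    refine (eVar_le_add (g := logDIter f m) (h := fun x => logDIter f n (Φ m x))
      fun x _ y _ => ?_).trans (add_le_add le_rfl ?_)
    · rw [logDIter_add h h1, logDIter_add h h1, add_sub_add_comm]
      exact abs_add_le _ _
    · exact eVariationOn.comp_le_of_monotoneOn (logDIter f n) (Φ m)
        (ico_mono h m) fun x hx => ico_icc h m hx
  have hm := logDIter_bv h h1 m
  have hn := logDIter_bv h h1 n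
  have := ENNReal.toReal_mono (ENNReal.add_ne_top.2 ⟨hm, hn⟩) key
  rwa [ENNReal.toReal_add hm hn] at this

lemma var_lim {f : C1bvDiffeo} {Φ Φ' : ℝ → ℝ → ℝ} (h : IsC1FlowOn (Ico (0:ℝ) 1) Φ Φ')
    (h1 : ∀ x : ℝ, Φ 1 x = f.toFun x) :
    ∃ V : ℝ, Tendsto (fun n : ℕ => varLogDIter f n / n) atTop (𝓝 V) := by
  refine ⟨_, (var_subadd h h1).tendsto_lim ⟨0, ?_⟩⟩
  rintro _ ⟨n, rfl⟩
  exact div_nonneg ENNReal.toReal_nonneg (Nat.cast_nonneg n)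

lemma dichotomy (f : C1bvDiffeo) (hnofix : ∀ x ∈ Ioo (0:ℝ) 1, f.toFun x ≠ x) :
    (∀ x ∈ Ioo (0:ℝ) 1, f.toFun x < x) ∨ (∀ x ∈ Ioo (0:ℝ) 1, x < f.toFun x) := by
  by_contra hcon
  push Not at hcon
  obtain ⟨⟨a, ha, ha'⟩, ⟨b, hb, hb'⟩⟩ := hcon
  have hcont : ContinuousOn f.toFun (Ioo 0 1) := fun x hx =>
    ((f.hasDeriv x (Ioo_subset_Icc_self hx)).continuousWithinAt).mono Ioo_subset_Icc_self
  obtain ⟨c, hc, hc'⟩ := isPreconnected_Ioo.intermediate_value₂ hb ha hcont continuousOn_id hb' ha'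
  exact hnofix c hc hc'

lemma log_ico {f : C1bvDiffeo} {Φ Φ' : ℝ → ℝ → ℝ} (h : IsC1FlowOn (Ico (0:ℝ) 1) Φ Φ')
    (h1 : ∀ x : ℝ, Φ 1 x = f.toFun x) {x : ℝ} (hx : x ∈ Ico (0:ℝ) 1) :
    Real.log (Φ' 1 x) = Real.log (f.derivFun x) := by
  have h2 : f.toFun = Φ 1 := (funext h1).symm
  have h3 := (f.hasDeriv x (Ico_subset_Icc_self hx)).mono Ico_subset_Icc_self
  rw [h2] at h3
  rw [(udIco x hx).eq_deriv _ (h.2.2.2.2.1 1 x hx) h3]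

lemma log_ioc {f : C1bvDiffeo} {Φ Φ' : ℝ → ℝ → ℝ} (h : IsC1FlowOn (Ioc (0:ℝ) 1) Φ Φ')
    (h1 : ∀ x : ℝ, Φ 1 x = f.toFun x) {x : ℝ} (hx : x ∈ Ioc (0:ℝ) 1) :
    Real.log (Φ' 1 x) = Real.log (f.derivFun x) := by
  have h2 : f.toFun = Φ 1 := (funext h1).symm
  have h3 := (f.hasDeriv x (Ioc_subset_Icc_self hx)).mono Ioc_subset_Icc_self
  rw [h2] at h3
  rw [(udIoc x hx).eq_deriv _ (h.2.2.2.2.1 1 x hx) h3]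

lemma log_neg_one {s : Set ℝ} {Φ Φ' : ℝ → ℝ → ℝ} (h : IsC1FlowOn s Φ Φ') (hs : UniqueDiffOn ℝ s)
    {x : ℝ} (hx : x ∈ s) : Real.log (Φ' (-1) x) = - Real.log (Φ' 1 (Φ (-1) x)) := by
  have h1 := h.logchain hs 1 (-1) hx
  rw [add_neg_cancel, h.log_zero hs hx] at h1
  linarith

lemma neg_one_cont {Φ Φ' Ψ Ψ' : ℝ → ℝ → ℝ} (hΦ : IsC1FlowOn (Ico (0:ℝ) 1) Φ Φ')
    (hΨ : IsC1FlowOn (Ioc (0:ℝ) 1) Ψ Ψ') (t : ℝ) (h : Ψ t = Φ t) :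
    ContinuousOn (Φ t) (Icc 0 1) := by
  intro x hx
  rcases hx.2.lt_or_eq with h1 | h1
  · have h2 := (hΦ.2.2.2.2.1 t x ⟨hx.1, h1⟩).continuousWithinAt
    refine h2.mono_of_mem_nhdsWithin ?_
    have : Iio (1:ℝ) ∈ 𝓝[Icc 0 1] x := mem_nhdsWithin_of_mem_nhds (Iio_mem_nhds h1)
    filter_upwards [this, self_mem_nhdsWithin] with y hy hy'
    exact ⟨hy'.1, hy⟩
  · have h0 : 0 < x := by rw [h1]; norm_num
    have h2 := (hΨ.2.2.2.2.1 t x ⟨h0, hx.2⟩).continuousWithinAt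
    rw [h] at h2
    refine h2.mono_of_mem_nhdsWithin ?_
    have : Ioi (0:ℝ) ∈ 𝓝[Icc 0 1] x := mem_nhdsWithin_of_mem_nhds (Ioi_mem_nhds h0)
    filter_upwards [this, self_mem_nhdsWithin] with y hy hy'
    exact ⟨hy, hy'.2⟩

lemma rev_sum {f : C1bvDiffeo} {Φ Φ' : ℝ → ℝ → ℝ} (h : IsC1FlowOn (Ico (0:ℝ) 1) Φ Φ')
    (h1 : ∀ x : ℝ, Φ 1 x = f.toFun x) (n : ℕ) (x : ℝ) :
    ∑ j ∈ Finset.range n, -Real.log (f.derivFun (Φ (-1) (Φ (-(j:ℝ)) x)))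
      = - logDIter f n (Φ (-(n:ℝ)) x) := by
  rw [logDIter_eq h h1, Finset.sum_neg_distrib, ← Finset.sum_range_reflect]
  congr 1
  refine Finset.sum_congr rfl fun k hk => ?_
  have hk' := Finset.mem_range.1 hk
  rw [← h.2.1, ← h.2.1]
  congr 3
  rw [Nat.sub_sub, Nat.cast_sub (by omega)]
  push_cast
  ring

lemma rev_var {f : C1bvDiffeo} {Φ Φ' : ℝ → ℝ → ℝ} (h : IsC1FlowOn (Ico (0:ℝ) 1) Φ Φ')
    (h1 : ∀ x : ℝ, Φ 1 x = f.toFun x) (n : ℕ) :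
    eVariationOn (fun x => ∑ j ∈ Finset.range n, -Real.log (f.derivFun (Φ (-1) (Φ (-(j:ℝ)) x))))
      (Icc 0 1) = eVariationOn (logDIter f n) (Icc 0 1) := by
  have h2 := eVariationOn.comp_eq_of_monotoneOn (logDIter f n) (Φ (-(n:ℝ))) (ico_mono h (-(n:ℝ)))
  rw [ico_surj h] at h2
  rw [← h2]
  simp only [rev_sum h h1]
  apply le_antisymm <;> refine eVar_le fun x _ y _ => le_of_eq ?_ <;>
    simp only [Function.comp] <;> rw [neg_sub_neg, abs_sub_comm]
/-- **Mather invariant and asymptotic variation.** Let `f` be a `C^{1+bv}` diffeomorphism of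
`[0,1]` with no interior fixed point. Let `Φ` (resp. `Ψ`) be the `C¹` flow on `[0,1)` (resp.
on `(0,1]`) into which `f` embeds, and let `M` be the Mather invariant of `f`, defined by
`Ψ_{M t}(1/2) = Φ_t(1/2)`. Then `M` is a `C^{1+bv}` diffeomorphism, the asymptotic variation
`V_∞(f) = lim var(log Dfⁿ)/n` exists, and
`|var(log DM) - V_∞(f)| ≤ |log Df(0)| + |log Df(1)|`. -/
theorem mather_invariant_estimate (f : C1bvDiffeo)
    (hnofix : ∀ x ∈ Ioo (0:ℝ) 1, f.toFun x ≠ x)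
    (Φ Φ' : ℝ → ℝ → ℝ) (hΦ : IsC1FlowOn (Ico (0:ℝ) 1) Φ Φ')
    (hΦ1 : ∀ x : ℝ, Φ 1 x = f.toFun x)
    (Ψ Ψ' : ℝ → ℝ → ℝ) (hΨ : IsC1FlowOn (Ioc (0:ℝ) 1) Ψ Ψ')
    (hΨ1 : ∀ x : ℝ, Ψ 1 x = f.toFun x)
    (M : ℝ → ℝ) (hM : ∀ t : ℝ, Ψ (M t) ((1:ℝ)/2) = Φ t ((1:ℝ)/2)) :
    -- the Mather invariant `M` is a `C^{1+bv}` diffeomorphism...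
    ∃ M' : ℝ → ℝ,
      (∀ t : ℝ, HasDerivAt M (M' t) t) ∧ Continuous M' ∧ (∀ t : ℝ, 0 < M' t) ∧
      BoundedVariationOn (fun t => Real.log (M' t)) (Icc (0:ℝ) 1) ∧
      -- ...and `|var(log DM) - V_∞(f)| ≤ |log Df(0)| + |log Df(1)|`
      ∃ V : ℝ, Tendsto (fun n : ℕ => varLogDIter f n / n) atTop (𝓝 V) ∧
        |(eVariationOn (fun t => Real.log (M' t)) (Icc (0:ℝ) 1)).toReal - V| ≤
          |Real.log (f.derivFun 0)| + |Real.log (f.derivFun 1)| := by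
  have hlc : ContinuousOn (fun x => Real.log (f.derivFun x)) (Icc 0 1) :=
    f.derivFun_cont.log fun x hx => (f.derivFun_pos x hx).ne'
  obtain ⟨V, hV⟩ := var_lim hΦ hΦ1
  rcases dichotomy f hnofix with hlt | hgt
  · have C : Core Φ Φ' Ψ Ψ' (fun x => Real.log (f.derivFun x)) :=
      { hΦ := hΦ
        hΨ := hΨ
        h1 := fun x => by rw [hΨ1, hΦ1]
        hlt := fun x hx => by rw [hΦ1]; exact hlt x hx
        hc := hlc
        hv := f.logDeriv_bv
        hlΦ := fun x hx => log_ico hΦ hΦ1 hx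
        hlΨ := fun x hx => log_ioc hΨ hΨ1 hx }
    obtain ⟨M', h1, h2, h3, _, h5, h6⟩ := C.main hM
    refine ⟨M', h1, h2, h3, h5, V, hV, h6 V ?_⟩
    refine hV.congr fun n => ?_
    rw [varLogDIter, logDIter_eq hΦ hΦ1]
  · have hinv : ∀ x, Ψ (-1) x = Φ (-1) x := fun x => by
      have h := hΨ.cancel_neg 1 x
      rw [hΨ1, ← hΦ1] at h
      rw [← hΦ.neg_cancel 1 (Ψ (-1) x), h]
    have C : Core (fun t => Φ (-t)) (fun t => Φ' (-t)) (fun t => Ψ (-t)) (fun t => Ψ' (-t))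
        (fun x => -Real.log (f.derivFun (Φ (-1) x))) :=
      { hΦ := hΦ.rev
        hΨ := hΨ.rev
        h1 := hinv
        hlt := fun x hx => by
          have h := hgt _ (ico_ioo hΦ (-1) hx)
          rw [← hΦ1, hΦ.cancel_neg] at h
          exact h
        hc := (hlc.comp (neg_one_cont hΦ hΨ (-1) (funext hinv))
          fun x hx => ico_icc hΦ (-1) hx).neg
        hv := by
          refine ne_top_of_le_ne_top f.logDeriv_bv ?_
          refine le_trans ?_ (eVariationOn.comp_le_of_monotoneOn
            (fun x => Real.log (f.derivFun x)) (Φ (-1)) (ico_mono hΦ (-1))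
            fun x hx => ico_icc hΦ (-1) hx)
          refine eVar_le fun x _ y _ => le_of_eq ?_
          simp only [Function.comp]
          rw [neg_sub_neg, abs_sub_comm]
        hlΦ := fun x hx => by
          change Real.log (Φ' (-1) x) = _
          rw [log_neg_one hΦ udIco hx, log_ico hΦ hΦ1 (hΦ.mem _ hx)]
        hlΨ := fun x hx => by
          change Real.log (Ψ' (-1) x) = _
          rw [log_neg_one hΨ udIoc hx, log_ioc hΨ hΨ1 (hΨ.mem _ hx), hinv] }
    have hN : ∀ t : ℝ, (fun t => Ψ (-t)) ((fun t => -M (-t)) t) ((1:ℝ)/2)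
        = (fun t => Φ (-t)) t ((1:ℝ)/2) := fun t => by
      simp only [neg_neg]
      exact hM (-t)
    obtain ⟨N', h1, h2, h3, h4, h5, h6⟩ := C.main (M := fun t => -M (-t)) hN
    have hvar : eVariationOn (fun t => Real.log (N' (-t))) (Icc 0 1)
        = eVariationOn (fun t => Real.log (N' t)) (Icc 0 1) := by
      have e := eVariationOn.comp_eq_of_antitoneOn (t := Icc (0:ℝ) 1)
        (fun t => Real.log (N' t)) (fun t : ℝ => 1 - t)
        (fun x _ y _ hxy => sub_le_sub_left hxy 1)
      rw [image_const_sub_Icc, sub_self, sub_zero] at e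
      rw [← e]
      congr 1
      ext t
      simp only [Function.comp]
      rw [← h4 (-t), neg_add_eq_sub]
    refine ⟨fun t => N' (-t), fun t => ?_, h2.comp continuous_neg, fun t => h3 _, ?_, V, hV, ?_⟩
    · have h := ((h1 (-t)).comp t (hasDerivAt_neg t)).neg
      simp only [Function.comp_def, neg_neg, mul_neg, mul_one] at h
      have e : (-fun x => -M x) = M := by
        funext s
        exact neg_neg (M s)
      rw [e] at h
      exact h
    · rw [BoundedVariationOn, hvar]
      exact h5
    · rw [hvar]
      have h7 := h6 V ?_
      · simp only [ico_zero hΦ, ico_one hΦ, abs_neg] at h7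
        exact h7
      · refine hV.congr fun n => ?_
        rw [rev_var hΦ hΦ1, varLogDIter]
end
end
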